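/- Let N be a positive integer, a ∈ ℝ^N, and let Γ : ℝ^N → ℝ be analytic in a neighborhood of a. Then there exist σ > 0 and θ ∈ (0, 1/2) such that for all x ∈ ℝ^N with ‖x − a‖ < σ, one has ‖∇Γ(x)‖ ≥ |Γ(x) − Γ(a)|^{1−θ}. -/

import Mathlib

open Filter Topology

/-- Telescoping decomposition of `P (y, …, y) - P (z, …, z)` for a multilinear map `P`. -/
theorem ContinuousMultilinearMap.sum_curryMid_sub {E : Type*} [NormedAddCommGroup E]
    [NormedSpace ℝ E] {n : ℕ} (P : ContinuousMultilinearMap ℝ (fun _ : Fin (n + 1) => E) ℝ)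
    (y z : E) :
    ∑ i : Fin (n + 1), P.curryMid i (y - z) (fun j : Fin n => if (j : ℕ) < i then z else y) =
      P (fun _ => y) - P (fun _ => z) := by
  set a : ℕ → ℝ := fun k => P (fun j : Fin (n + 1) => if (j : ℕ) < k then z else y) with ha
  have h1 : ∀ i : Fin (n + 1),
      P.curryMid i (y - z) (fun j : Fin n => if (j : ℕ) < i then z else y) =
        a i - a (i + 1) := by
    intro i
    rw [map_sub, sub_apply, ContinuousMultilinearMap.curryMid_apply,
      ContinuousMultilinearMap.curryMid_apply]
    congr 2
    · ext j
      refine Fin.succAboveCases i ?_ (fun j => ?_) j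
      · simp
      · have : (i.succAbove j : ℕ) < i ↔ (j : ℕ) < i := by
          simp only [Fin.succAbove, Fin.lt_def]
          split_ifs <;> simp_all; omega
        simp [this]
    · ext j
      refine Fin.succAboveCases i ?_ (fun j => ?_) j
      · simp
      · have : (i.succAbove j : ℕ) < i + 1 ↔ (j : ℕ) < i := by
          simp only [Fin.succAbove, Fin.lt_def]
          split_ifs <;> simp_all; omega
        simp [this]
  rw [Finset.sum_congr rfl (fun i _ => h1 i), Fin.sum_univ_eq_sum_range (fun i => a i - a (i + 1)),
    Finset.sum_range_sub']
  simp [ha, Fin.is_le]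

/-- Division with parameters: an analytic germ is its restriction to the kernel of `ℓ` plus a
multiple of `ℓ`. -/
theorem AnalyticAt.exists_eq_comp_add_mul {E : Type*} [NormedAddCommGroup E] [NormedSpace ℝ E]
    {f : E → ℝ} (hf : AnalyticAt ℝ f 0) (ℓ : E →L[ℝ] ℝ) (e : E) :
    ∃ g : E → ℝ, AnalyticAt ℝ g 0 ∧ ∀ᶠ y in 𝓝 (0 : E), f y = f (y - ℓ y • e) + ℓ y * g y := by
  obtain ⟨p, r, hp⟩ := hf
  set π : E →L[ℝ] E := ContinuousLinearMap.id ℝ E - ℓ.smulRight e with hπ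
  have hπy : ∀ y, π y = y - ℓ y • e := fun y => by simp [hπ]
  set q : FormalMultilinearSeries ℝ E ℝ := fun n =>
    ∑ i : Fin (n + 1), ((p (n + 1)).curryMid i e).compContinuousLinearMap
      (fun j : Fin n => if (j : ℕ) < i then π else ContinuousLinearMap.id ℝ E) with hq
  set K : ℝ := max 1 ‖π‖ with hK
  have hK1 : 1 ≤ K := le_max_left _ _
  have hqn : ∀ n, ‖q n‖ ≤ (n + 1) * (‖p (n + 1)‖ * ‖e‖ * K ^ n) := by
    intro n
    refine (norm_sum_le _ _).trans ((Finset.sum_le_card_nsmul _ _ (‖p (n + 1)‖ * ‖e‖ * K ^ n)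
      fun i _ => ?_).trans_eq (by simp))
    refine (ContinuousMultilinearMap.norm_compContinuousLinearMap_le _ _).trans ?_
    gcongr
    · refine (ContinuousLinearMap.le_opNorm _ _).trans ?_
      gcongr
      exact MultilinearMap.mkContinuousLinear_norm_le _ (norm_nonneg _) _
    · refine (Finset.prod_le_prod (g := fun _ => K) (fun _ _ => norm_nonneg _)
        fun j _ => ?_).trans_eq (by simp)
      split_ifs
      · exact le_max_right _ _
      · exact ContinuousLinearMap.norm_id_le.trans hK1
  have hterm : ∀ n y, p (n + 1) (fun _ => y) - p (n + 1) (fun _ => π y) =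
      ℓ y * q n (fun _ => y) := by
    intro n y
    rw [← ContinuousMultilinearMap.sum_curryMid_sub, hq]
    simp only [sum_apply, Finset.mul_sum]
    refine Finset.sum_congr rfl fun i _ => ?_
    have : y - π y = ℓ y • e := by simp [hπy]
    rw [this, map_smul, smul_apply, smul_eq_mul,
      ContinuousMultilinearMap.compContinuousLinearMap_apply]
    congr 2
    ext j
    split_ifs <;> simp
  have hrad : 0 < q.radius := by
    obtain ⟨ρ, hρ0, hρ⟩ := ENNReal.lt_iff_exists_nnreal_btwn.1 hp.radius_pos
    have hρ0' : 0 < (ρ : ℝ) := by exact_mod_cast hρ0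
    obtain ⟨C, hC, hCn⟩ := p.norm_mul_pow_le_of_lt_radius hρ
    have hK0 : 0 < K := by linarith
    set ρ' : NNReal := ⟨ρ / (2 * K), by positivity⟩ with hρ'
    have hρc : (ρ' : ℝ) = ρ / (2 * K) := rfl
    refine lt_of_lt_of_le ?_ (q.le_radius_of_bound (C * ‖e‖ / ρ) (r := ρ') fun n => ?_)
    · have : 0 < (ρ' : ℝ) := by rw [hρc]; positivity
      exact_mod_cast this
    · calc ‖q n‖ * (ρ' : ℝ) ^ n
          ≤ (n + 1) * (‖p (n + 1)‖ * ‖e‖ * K ^ n) * (ρ' : ℝ) ^ n := by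
            gcongr; exact hqn n
        _ = (n + 1) / 2 ^ n * ((‖p (n + 1)‖ * ρ ^ (n + 1)) * ‖e‖ / ρ) := by
            rw [hρc, div_pow, mul_pow]
            field_simp
            ring
        _ ≤ 1 * (C * ‖e‖ / ρ) := by
            gcongr
            · rw [div_le_one (by positivity)]
              exact_mod_cast Nat.lt_two_pow_self
            · exact hCn _
        _ = C * ‖e‖ / ρ := one_mul _
  have hg := q.hasFPowerSeriesOnBall hrad
  refine ⟨q.sum, hg.analyticAt, ?_⟩
  have hπ0 : Tendsto π (𝓝 0) (𝓝 0) := by simpa using π.continuous.tendsto 0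
  filter_upwards [Metric.eball_mem_nhds (0 : E) hp.r_pos, Metric.eball_mem_nhds (0 : E) hrad,
    hπ0 (Metric.eball_mem_nhds (0 : E) hp.r_pos)] with y h1 h2 h3
  have s1 := (hp.hasSum h1).sub (hp.hasSum h3)
  have s2 := (hg.hasSum h2).mul_left (ℓ y)
  simp only [zero_add] at s1 s2
  rw [← hasSum_nat_add_iff' 1] at s1
  simp only [hterm] at s1
  have h0 : p 0 (fun _ => y) = p 0 (fun _ => π y) := by congr 1; ext i; exact i.elim0
  have := s1.unique s2
  simp only [Finset.range_one, Finset.sum_singleton, h0, sub_self, sub_zero] at this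
  rw [← hπy]
  linarith

/-- The ring of analytic germs is a domain. -/
theorem AnalyticAt.eventually_eq_zero_or_of_mul {E : Type*} [NormedAddCommGroup E]
    [NormedSpace ℝ E] {f g : E → ℝ} {a : E} (hf : AnalyticAt ℝ f a) (hg : AnalyticAt ℝ g a)
    (h : ∀ᶠ x in 𝓝 a, f x * g x = 0) : (∀ᶠ x in 𝓝 a, f x = 0) ∨ ∀ᶠ x in 𝓝 a, g x = 0 := by
  obtain ⟨ε, hε, hball⟩ := Metric.eventually_nhds_iff_ball.1
    (hf.eventually_analyticAt.and (hg.eventually_analyticAt.and h))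
  by_contra! hcon
  obtain ⟨hf0, hg0⟩ := hcon
  obtain ⟨x, hfx, hx⟩ := (hf0.and_eventually (Metric.ball_mem_nhds a hε)).exists
  have hgx : g =ᶠ[𝓝 x] 0 := by
    filter_upwards [(hball x hx).1.continuousAt.eventually_ne hfx,
      Metric.isOpen_ball.mem_nhds hx] with y hy hyb
    exact (mul_eq_zero.1 (hball y hyb).2.2).resolve_left hy
  have hgb : AnalyticOnNhd ℝ g (Metric.ball a ε) := fun y hy => (hball y hy).2.1
  have := hgb.eqOn_zero_of_preconnected_of_eventuallyEq_zero
    (convex_ball a ε).isPreconnected hx hgx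
  refine hg0 ?_
  filter_upwards [Metric.ball_mem_nhds a hε] with y hy using not_not.2 (this hy)

namespace Lojasiewicz

variable {n : ℕ}

/-- A germ at the origin which is a monomial times a unit. -/
def IsMonomial (f : (Fin n → ℝ) → ℝ) : Prop :=
  ∃ (α : Fin n → ℕ) (u : (Fin n → ℝ) → ℝ), AnalyticAt ℝ u 0 ∧ u 0 ≠ 0 ∧
    f =ᶠ[𝓝 0] fun x => (∏ i, x i ^ α i) * u x

/-- A germ at the origin which is zero or a monomial times a unit. -/
def IsZeroOrMonomial (f : (Fin n → ℝ) → ℝ) : Prop :=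
  f =ᶠ[𝓝 0] 0 ∨ IsMonomial f

/-- `φ` is an analytic map germ fixing the origin which has a section `s` along the filter `𝒰`. -/
structure Uniformizes (𝒰 : Filter (Fin n → ℝ)) (φ s : (Fin n → ℝ) → Fin n → ℝ) : Prop where
  analyticAt : AnalyticAt ℝ φ 0
  map_zero : φ 0 = 0
  tendsto : Tendsto s 𝒰 (𝓝 0)
  section_eq : ∀ᶠ x in 𝒰, φ (s x) = x

/-- Along every ultrafilter converging to the origin, `f` can be made zero or monomial by
an analytic change of variables. -/
def Resolvable (f : (Fin n → ℝ) → ℝ) : Prop :=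
  ∀ 𝒰 : Ultrafilter (Fin n → ℝ), (𝒰 : Filter (Fin n → ℝ)) ≤ 𝓝 0 →
    ∃ φ s, Uniformizes (𝒰 : Filter (Fin n → ℝ)) φ s ∧ IsZeroOrMonomial (f ∘ φ)

theorem prod_pow_add_single (x : Fin n → ℝ) (α : Fin n → ℕ) (k : Fin n) :
    ∏ i, x i ^ (α + Pi.single k 1 : Fin n → ℕ) i = (∏ i, x i ^ α i) * x k := by
  simp only [Pi.add_apply, pow_add, Finset.prod_mul_distrib]
  congr 1
  rw [Finset.prod_eq_single k] <;> simp +contextual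

theorem exists_eq_add_single {α : Fin n → ℕ} {k : Fin n} (hk : α k ≠ 0) :
    ∃ β : Fin n → ℕ, α = β + Pi.single k 1 ∧ ∑ i, α i = ∑ i, β i + 1 := by
  have h : α = (α - Pi.single k 1) + Pi.single k 1 := by
    ext i
    by_cases hi : i = k
    · subst hi; simp; omega
    · simp [hi]
  refine ⟨_, h, ?_⟩
  conv_lhs => rw [h]
  simp [Finset.sum_add_distrib, Finset.sum_pi_single']

theorem eventuallyEq_of_mul_coord {f g : (Fin n → ℝ) → ℝ} (hf : AnalyticAt ℝ f 0)
    (hg : AnalyticAt ℝ g 0) (k : Fin n) (h : ∀ᶠ x in 𝓝 0, x k * f x = x k * g x) :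
    f =ᶠ[𝓝 0] g := by
  have hk : AnalyticAt ℝ (fun x : Fin n → ℝ => x k) 0 :=
    (ContinuousLinearMap.proj (R := ℝ) (φ := fun _ : Fin n => ℝ) k).analyticAt 0
  rcases hk.eventually_eq_zero_or_of_mul (hf.fun_sub hg)
    (h.mono fun x hx => by rw [mul_sub, hx, sub_self]) with h0 | h0
  · exfalso
    have ht : Tendsto (fun t : ℝ => Pi.single k t) (𝓝[≠] 0) (𝓝 (0 : Fin n → ℝ)) := by
      have : Continuous (fun t : ℝ => (Pi.single k t : Fin n → ℝ)) :=
        continuous_single (A := fun _ : Fin n => ℝ) k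
      simpa using (this.tendsto 0).mono_left nhdsWithin_le_nhds
    have := (ht.eventually h0).and (eventually_mem_nhdsWithin)
    obtain ⟨t, ht1, ht2⟩ := this.exists
    exact ht2 (by simpa using ht1)
  · exact h0.mono fun x hx => sub_eq_zero.1 hx

/-- A factor of a monomial is a monomial. -/
theorem IsMonomial.of_mul {f g : (Fin n → ℝ) → ℝ} (hf : AnalyticAt ℝ f 0)
    (hg : AnalyticAt ℝ g 0) (h : IsMonomial fun x => f x * g x) : IsMonomial f := by
  obtain ⟨α, u, hu, hu0, he⟩ := h
  induction hN : ∑ i, α i generalizing α f g with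
  | zero =>
    have hα : ∀ i, α i = 0 := by simpa using hN
    refine ⟨0, f, hf, ?_, by simp⟩
    have := he.self_of_nhds
    simp only [hα, pow_zero, Finset.prod_const_one, one_mul] at this
    exact left_ne_zero_of_mul (this ▸ hu0)
  | succ N ih =>
    obtain ⟨k, hk⟩ : ∃ k, α k ≠ 0 := by
      by_contra! hcon
      simp [hcon] at hN
    obtain ⟨β, rfl, hβ⟩ := exists_eq_add_single hk
    have hβN : ∑ i, β i = N := by omega
    set ℓ := ContinuousLinearMap.proj (R := ℝ) (φ := fun _ : Fin n => ℝ) k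
    have hℓ : ∀ x, ℓ x = x k := fun _ => rfl
    set π : (Fin n → ℝ) → Fin n → ℝ := fun x => x - ℓ x • Pi.single k 1 with hπ
    have hπa : AnalyticAt ℝ π 0 :=
      analyticAt_id.fun_sub ((ℓ.analyticAt 0).fun_smul analyticAt_const)
    have hπ0 : π 0 = 0 := by simp [hπ]
    have hπt : Tendsto π (𝓝 0) (𝓝 0) := by simpa [hπ0] using hπa.continuousAt.tendsto
    have hπk : ∀ x, π x k = 0 := fun x => by simp [hπ, hℓ]
    have hm : AnalyticAt ℝ (fun x : Fin n → ℝ => (∏ i, x i ^ β i) * u x) 0 := by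
      refine AnalyticAt.fun_mul ?_ hu
      exact Finset.analyticAt_fun_prod _ fun i _ =>
        ((ContinuousLinearMap.proj (R := ℝ) (φ := fun _ : Fin n => ℝ) i).analyticAt 0).fun_pow _
    obtain ⟨f', hf', hff'⟩ := hf.exists_eq_comp_add_mul ℓ (Pi.single k 1)
    obtain ⟨g', hg', hgg'⟩ := hg.exists_eq_comp_add_mul ℓ (Pi.single k 1)
    have hfg : ∀ᶠ x in 𝓝 0, (f ∘ π) x * (g ∘ π) x = 0 := by
      filter_upwards [hπt.eventually he] with x hx
      simp only [Function.comp_apply, hx, prod_pow_add_single, hπk]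
      ring
    rcases (hf.comp_of_eq hπa hπ0).eventually_eq_zero_or_of_mul (hg.comp_of_eq hπa hπ0) hfg
      with h0 | h0
    · have h1 : ∀ᶠ x in 𝓝 0, f x = x k * f' x := by
        filter_upwards [hff', h0] with x hx hx0
        rw [hx]
        simp only [Function.comp_apply, hπ] at hx0
        rw [hx0, zero_add, hℓ]
      obtain ⟨γ, v, hv, hv0, hve⟩ := ih hf' hg β (eventuallyEq_of_mul_coord (hf'.fun_mul hg) hm k
        (by
          filter_upwards [h1, he] with x hx hx2
          rw [hx, prod_pow_add_single] at hx2
          linarith)) hβN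
      refine ⟨γ + Pi.single k 1, v, hv, hv0, ?_⟩
      filter_upwards [h1, hve] with x hx hx2
      rw [hx, hx2, prod_pow_add_single]
      ring
    · have h1 : ∀ᶠ x in 𝓝 0, g x = x k * g' x := by
        filter_upwards [hgg', h0] with x hx hx0
        rw [hx]
        simp only [Function.comp_apply, hπ] at hx0
        rw [hx0, zero_add, hℓ]
      exact ih hf hg' β (eventuallyEq_of_mul_coord (hf.fun_mul hg') hm k
        (by
          filter_upwards [h1, he] with x hx hx2
          rw [hx, prod_pow_add_single] at hx2
          linarith)) hβN

theorem Uniformizes.refl {𝒰 : Filter (Fin n → ℝ)} (h : 𝒰 ≤ 𝓝 0) : Uniformizes 𝒰 id id :=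
  ⟨analyticAt_id, rfl, h, Eventually.of_forall fun _ => rfl⟩

theorem Uniformizes.comp {𝒰 : Filter (Fin n → ℝ)} {φ s ψ t : (Fin n → ℝ) → Fin n → ℝ}
    (h : Uniformizes 𝒰 φ s) (h' : Uniformizes (𝒰.map s) ψ t) :
    Uniformizes 𝒰 (φ ∘ ψ) (t ∘ s) := by
  refine ⟨h.analyticAt.comp_of_eq h'.analyticAt h'.map_zero, by simp [h'.map_zero, h.map_zero],
    h'.tendsto.comp tendsto_map, ?_⟩
  filter_upwards [h.section_eq, eventually_map.1 h'.section_eq] with x h1 h2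
  simp [h2, h1]

theorem Uniformizes.tendsto_nhds {𝒰 : Filter (Fin n → ℝ)} {φ s : (Fin n → ℝ) → Fin n → ℝ}
    (h : Uniformizes 𝒰 φ s) : Tendsto φ (𝓝 0) (𝓝 0) := by
  simpa [h.map_zero] using h.analyticAt.continuousAt.tendsto

theorem Resolvable.of_uniformizes {f : (Fin n → ℝ) → ℝ}
    (h : ∀ 𝒰 : Ultrafilter (Fin n → ℝ), (𝒰 : Filter (Fin n → ℝ)) ≤ 𝓝 0 →
      ∃ φ s, Uniformizes (𝒰 : Filter (Fin n → ℝ)) φ s ∧ Resolvable (f ∘ φ)) : Resolvable f := by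
  intro 𝒰 h𝒰
  obtain ⟨φ, s, hφ, hres⟩ := h 𝒰 h𝒰
  obtain ⟨ψ, t, hψ, hm⟩ := hres (𝒰.map s) hφ.tendsto
  exact ⟨φ ∘ ψ, t ∘ s, hφ.comp hψ, hm⟩

theorem IsZeroOrMonomial.congr {f g : (Fin n → ℝ) → ℝ} (hf : IsZeroOrMonomial f)
    (h : g =ᶠ[𝓝 0] f) : IsZeroOrMonomial g := by
  rcases hf with hf | ⟨α, u, hu, hu0, he⟩
  · exact Or.inl (h.trans hf)
  · exact Or.inr ⟨α, u, hu, hu0, h.trans he⟩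

theorem IsZeroOrMonomial.resolvable {f : (Fin n → ℝ) → ℝ} (hf : IsZeroOrMonomial f) :
    Resolvable f :=
  fun _ h𝒰 => ⟨id, id, Uniformizes.refl h𝒰, hf⟩

theorem Resolvable.congr {f g : (Fin n → ℝ) → ℝ} (hf : Resolvable f) (h : g =ᶠ[𝓝 0] f) :
    Resolvable g := by
  intro 𝒰 h𝒰
  obtain ⟨φ, s, hφ, hm⟩ := hf 𝒰 h𝒰
  exact ⟨φ, s, hφ, hm.congr (hφ.tendsto_nhds.eventually h)⟩

/-- Simultaneous resolution of finitely many germs. -/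
theorem exists_uniformizes_family (hn : ∀ f : (Fin n → ℝ) → ℝ, AnalyticAt ℝ f 0 → Resolvable f)
    {ι : Type*} (S : Finset ι) (f : ι → (Fin n → ℝ) → ℝ) (hf : ∀ i ∈ S, AnalyticAt ℝ (f i) 0)
    (𝒰 : Ultrafilter (Fin n → ℝ)) (h𝒰 : (𝒰 : Filter (Fin n → ℝ)) ≤ 𝓝 0) :
    ∃ φ s, Uniformizes (𝒰 : Filter (Fin n → ℝ)) φ s ∧
      ∀ i ∈ S, IsZeroOrMonomial (f i ∘ φ) := by
  classical
  induction hN : S.card generalizing S f 𝒰 with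
  | zero =>
    rw [Finset.card_eq_zero] at hN
    exact ⟨id, id, Uniformizes.refl h𝒰, by simp [hN]⟩
  | succ N ih =>
    obtain ⟨φ, s, hφ, hm⟩ := hn (fun x => ∏ i ∈ S, f i x)
      (Finset.analyticAt_fun_prod _ hf) 𝒰 h𝒰
    have hfφ : ∀ i ∈ S, AnalyticAt ℝ (f i ∘ φ) 0 := fun i hi =>
      (hf i hi).comp_of_eq hφ.analyticAt hφ.map_zero
    rcases hm with hz | hm
    · obtain ⟨i, hi, hiz⟩ : ∃ i ∈ S, f i ∘ φ =ᶠ[𝓝 0] 0 := by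
        clear ih hN hf
        induction S using Finset.induction_on with
        | empty =>
          have := hz.self_of_nhds
          simp at this
        | insert a S ha ih =>
          rcases (hfφ a (by simp)).eventually_eq_zero_or_of_mul
            (g := fun x => ∏ i ∈ S, (f i ∘ φ) x)
            (Finset.analyticAt_fun_prod _ fun i hi => hfφ i (by simp [hi]))
            (by
              filter_upwards [hz] with x hx
              simpa [Finset.prod_insert ha] using hx) with h | h
          · exact ⟨a, by simp, h⟩
          · obtain ⟨i, hi, hiz⟩ := ih (fun i hi => hfφ i (by simp [hi])) h
            exact ⟨i, by simp [hi], hiz⟩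
      obtain ⟨ψ, t, hψ, hψm⟩ := ih (S.erase i) (fun j => f j ∘ φ)
        (fun j hj => hfφ j (Finset.mem_of_mem_erase hj)) (𝒰.map s) hφ.tendsto
        (by rw [Finset.card_erase_of_mem hi, hN]; rfl)
      refine ⟨φ ∘ ψ, t ∘ s, hφ.comp hψ, fun j hj => ?_⟩
      by_cases hji : j = i
      · subst hji
        exact Or.inl (hψ.tendsto_nhds.eventually hiz)
      · exact hψm j (Finset.mem_erase.2 ⟨hji, hj⟩)
    · refine ⟨φ, s, hφ, fun i hi => Or.inr ?_⟩
      refine IsMonomial.of_mul (g := fun x => ∏ j ∈ S.erase i, (f j ∘ φ) x) (hfφ i hi)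
        (Finset.analyticAt_fun_prod _ fun j hj => hfφ j (Finset.mem_of_mem_erase hj)) ?_
      convert hm using 2 with x
      simp [Finset.mul_prod_erase S (fun j => f j (φ x)) hi]

theorem analyticAt_coord (i : Fin n) (a : Fin n → ℝ) : AnalyticAt ℝ (fun x : Fin n → ℝ => x i) a :=
  (ContinuousLinearMap.proj (R := ℝ) (φ := fun _ : Fin n => ℝ) i).analyticAt a

theorem analyticAt_tail (a : Fin (n + 1) → ℝ) :
    AnalyticAt ℝ (fun X : Fin (n + 1) → ℝ => Fin.tail X) a :=
  AnalyticAt.pi fun i => analyticAt_coord i.succ a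

theorem analyticAt_cons {E : Type*} [NormedAddCommGroup E] [NormedSpace ℝ E] {z : E → ℝ}
    {x : E → Fin n → ℝ} {a : E} (hz : AnalyticAt ℝ z a) (hx : AnalyticAt ℝ x a) :
    AnalyticAt ℝ (fun y => (Fin.cons (z y) (x y) : Fin (n + 1) → ℝ)) a := by
  refine AnalyticAt.pi fun i => ?_
  induction i using Fin.cases with
  | zero => simpa using hz
  | succ i => simpa using analyticAt_pi_iff.1 hx i

theorem tail_zero : Fin.tail (0 : Fin (n + 1) → ℝ) = 0 := rfl

theorem cons_zero_zero : (Fin.cons 0 0 : Fin (n + 1) → ℝ) = 0 := by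
  ext i
  induction i using Fin.cases <;> simp

theorem tendsto_tail : Tendsto (fun X : Fin (n + 1) → ℝ => Fin.tail X) (𝓝 0) (𝓝 0) :=
  (analyticAt_tail 0).continuousAt.tendsto

theorem tendsto_cons {ι : Type*} {l : Filter ι} {z : ι → ℝ} {x : ι → Fin n → ℝ}
    (hz : Tendsto z l (𝓝 0)) (hx : Tendsto x l (𝓝 0)) :
    Tendsto (fun y => (Fin.cons (z y) (x y) : Fin (n + 1) → ℝ)) l (𝓝 0) := by
  rw [tendsto_pi_nhds] at hx ⊢
  intro i
  induction i using Fin.cases with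
  | zero => simpa using hz
  | succ i => simpa using hx i

theorem analyticAt_comp_tail {f : (Fin n → ℝ) → ℝ} (hf : AnalyticAt ℝ f 0) :
    AnalyticAt ℝ (fun X : Fin (n + 1) → ℝ => f (Fin.tail X)) 0 :=
  hf.comp_of_eq (analyticAt_tail 0) rfl

theorem Uniformizes.lift {𝒰 : Filter (Fin (n + 1) → ℝ)} (h𝒰 : 𝒰 ≤ 𝓝 0)
    {φ s : (Fin n → ℝ) → Fin n → ℝ} (h : Uniformizes (𝒰.map Fin.tail) φ s) :
    Uniformizes 𝒰 (fun X => Fin.cons (X 0) (φ (Fin.tail X)))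
      (fun X => Fin.cons (X 0) (s (Fin.tail X))) where
  analyticAt := analyticAt_cons (analyticAt_coord 0 0)
    (h.analyticAt.comp_of_eq (analyticAt_tail 0) rfl)
  map_zero := by
    simp only [tail_zero, h.map_zero, Pi.zero_apply, cons_zero_zero]
  tendsto := tendsto_cons ((analyticAt_coord 0 0).continuousAt.tendsto.mono_left h𝒰)
    (h.tendsto.comp tendsto_map)
  section_eq := by
    filter_upwards [eventually_map.1 h.section_eq] with X hX
    simp [hX]

theorem IsMonomial.mul {f g : (Fin n → ℝ) → ℝ} (hf : IsMonomial f) (hg : IsMonomial g) :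
    IsMonomial fun x => f x * g x := by
  obtain ⟨α, u, hu, hu0, he⟩ := hf
  obtain ⟨β, v, hv, hv0, he'⟩ := hg
  refine ⟨α + β, _, hu.fun_mul hv, mul_ne_zero hu0 hv0, ?_⟩
  filter_upwards [he, he'] with x hx hx'
  simp only [hx, hx', Pi.add_apply, pow_add, Finset.prod_mul_distrib]
  ring

theorem isMonomial_of_ne_zero {f : (Fin n → ℝ) → ℝ} (hf : AnalyticAt ℝ f 0) (h0 : f 0 ≠ 0) :
    IsMonomial f :=
  ⟨0, f, hf, h0, by simp⟩

theorem IsMonomial.congr {f g : (Fin n → ℝ) → ℝ} (hf : IsMonomial f) (h : g =ᶠ[𝓝 0] f) :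
    IsMonomial g := by
  obtain ⟨α, u, hu, hu0, he⟩ := hf
  exact ⟨α, u, hu, hu0, h.trans he⟩

theorem isMonomial_coord (k : Fin n) : IsMonomial fun x : Fin n → ℝ => x k := by
  refine ⟨0 + Pi.single k 1, fun _ => 1, analyticAt_const, one_ne_zero, ?_⟩
  filter_upwards with x
  rw [prod_pow_add_single]
  simp

theorem IsMonomial.pow {f : (Fin n → ℝ) → ℝ} (hf : IsMonomial f) (d : ℕ) :
    IsMonomial fun x => f x ^ d := by
  induction d with
  | zero => simpa using isMonomial_of_ne_zero (f := fun _ => 1) analyticAt_const one_ne_zero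
  | succ d ih => simpa only [pow_succ] using ih.mul hf

theorem IsMonomial.prod {ι : Type*} {S : Finset ι} {f : ι → (Fin n → ℝ) → ℝ}
    (hf : ∀ i ∈ S, IsMonomial (f i)) : IsMonomial fun x => ∏ i ∈ S, f i x := by
  classical
  induction S using Finset.induction_on with
  | empty => simpa using isMonomial_of_ne_zero (f := fun _ => 1) analyticAt_const one_ne_zero
  | insert a S ha ih =>
    simp only [Finset.prod_insert ha]
    exact (hf a (by simp)).mul (ih fun i hi => hf i (by simp [hi]))

theorem IsMonomial.comp {k : ℕ} {f : (Fin n → ℝ) → ℝ} (hf : IsMonomial f)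
    {φ : (Fin k → ℝ) → Fin n → ℝ} (hφ : AnalyticAt ℝ φ 0) (h0 : φ 0 = 0)
    (hm : ∀ i, IsMonomial fun x => φ x i) : IsMonomial fun x => f (φ x) := by
  obtain ⟨α, u, hu, hu0, he⟩ := hf
  have ht : Tendsto φ (𝓝 0) (𝓝 0) := by simpa [h0] using hφ.continuousAt.tendsto
  refine IsMonomial.congr ?_ (ht.eventually he)
  exact (IsMonomial.prod fun i _ => (hm i).pow (α i)).mul
    (isMonomial_of_ne_zero (hu.comp_of_eq hφ h0) (by simpa [h0] using hu0))

theorem IsMonomial.comp_tail {f : (Fin n → ℝ) → ℝ} (hf : IsMonomial f) :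
    IsMonomial fun X : Fin (n + 1) → ℝ => f (Fin.tail X) :=
  hf.comp (analyticAt_tail 0) rfl fun i => isMonomial_coord i.succ

theorem IsZeroOrMonomial.comp_tail {f : (Fin n → ℝ) → ℝ} (hf : IsZeroOrMonomial f) :
    IsZeroOrMonomial fun X : Fin (n + 1) → ℝ => f (Fin.tail X) := by
  rcases hf with hf | hf
  · exact Or.inl (tendsto_tail.eventually hf)
  · exact Or.inr hf.comp_tail

theorem IsZeroOrMonomial.mul {f g : (Fin n → ℝ) → ℝ} (hf : IsZeroOrMonomial f)
    (hg : IsMonomial g) : IsZeroOrMonomial fun x => f x * g x := by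
  rcases hf with hf | hf
  · exact Or.inl (by filter_upwards [hf] with x hx; simp [hx])
  · exact Or.inr (hf.mul hg)

/-- Taylor expansion in the first variable, with analytic coefficients and remainder. -/
theorem exists_expansion {g : (Fin (n + 1) → ℝ) → ℝ} (hg : AnalyticAt ℝ g 0) (d : ℕ) :
    ∃ (c : ℕ → (Fin n → ℝ) → ℝ) (u : (Fin (n + 1) → ℝ) → ℝ), (∀ j, AnalyticAt ℝ (c j) 0) ∧
      AnalyticAt ℝ u 0 ∧ ∀ᶠ X in 𝓝 0,
        g X = ∑ j ∈ Finset.range d, c j (Fin.tail X) * X 0 ^ j + X 0 ^ d * u X := by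
  induction d with
  | zero => exact ⟨0, g, fun _ => analyticAt_const, hg, by simp⟩
  | succ d ih =>
    obtain ⟨c, u, hc, hu, he⟩ := ih
    obtain ⟨v, hv, hve⟩ := hu.exists_eq_comp_add_mul
      (ContinuousLinearMap.proj (R := ℝ) (φ := fun _ : Fin (n + 1) => ℝ) 0) (Pi.single 0 1)
    have h0 : ∀ X : Fin (n + 1) → ℝ, X - X 0 • Pi.single 0 1 = Fin.cons 0 (Fin.tail X) := by
      intro X
      ext i
      induction i using Fin.cases <;> simp [Fin.tail]
    refine ⟨fun j => if j = d then fun x => u (Fin.cons 0 x) else c j, v, fun j => ?_, hv, ?_⟩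
    · dsimp only
      split_ifs with hj
      · exact hu.comp_of_eq (analyticAt_cons analyticAt_const analyticAt_id) cons_zero_zero
      · exact hc j
    · filter_upwards [he, hve] with X hX hX'
      rw [hX, Finset.sum_range_succ]
      simp only [ContinuousLinearMap.proj_apply, h0] at hX'
      rw [if_pos rfl, hX', Finset.sum_congr rfl fun j hj => ?_]
      · ring
      · rw [if_neg (Finset.mem_range.1 hj).ne]

/-- The coefficients of a Taylor expansion are given by the iterated derivatives. -/
theorem iteratedDeriv_eq_of_expansion {k U : ℝ → ℝ} {c : ℕ → ℝ} {d : ℕ} (hU : AnalyticAt ℝ U 0)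
    (h : ∀ᶠ t in 𝓝 0, k t = ∑ j ∈ Finset.range d, c j * t ^ j + t ^ d * U t) {i : ℕ}
    (hi : i < d) : iteratedDeriv i k 0 = i.factorial * c i := by
  have hpow : AnalyticAt ℝ (fun t : ℝ => t ^ d * U t) 0 := (analyticAt_id.fun_pow d).fun_mul hU
  have h1 : iteratedDeriv i (fun t : ℝ => t ^ d * U t) 0 = 0 := by
    refine (natCast_le_analyticOrderAt_iff_iteratedDeriv_eq_zero hpow).1 ?_ i hi
    refine (natCast_le_analyticOrderAt hpow).2 ⟨U, hU, ?_⟩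
    simp
  have h2 : ∀ j ∈ Finset.range d, AnalyticAt ℝ (fun t : ℝ => c j * t ^ j) 0 := fun j _ =>
    analyticAt_const.fun_mul (analyticAt_id.fun_pow j)
  rw [EventuallyEq.iteratedDeriv_eq i h, iteratedDeriv_fun_add
    (Finset.analyticAt_fun_sum _ h2).contDiffAt hpow.contDiffAt, h1, add_zero,
    iteratedDeriv_fun_sum fun j hj => (h2 j hj).contDiffAt]
  rw [Finset.sum_eq_single i]
  · rw [iteratedDeriv_const_mul_field, iteratedDeriv_fun_pow_zero]
    simp [mul_comm]
  · intro j _ hj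
    rw [iteratedDeriv_const_mul_field, iteratedDeriv_fun_pow_zero]
    simp [hj.symm]
  · intro hmem
    exact absurd (Finset.mem_range.2 hi) hmem

/-- Products of a germ in the last `n` variables with a germ regular of order at most `d` in the
first variable are resolvable. -/
def RegularResolvable (n d : ℕ) : Prop :=
  ∀ (g : (Fin (n + 1) → ℝ) → ℝ) (m : (Fin n → ℝ) → ℝ), AnalyticAt ℝ g 0 → AnalyticAt ℝ m 0 →
    iteratedDeriv d (fun t => g (Fin.cons t 0)) 0 ≠ 0 → Resolvable fun X => m (Fin.tail X) * g X

/-- Two-chart blow-up of the locus `X 0 = X k.succ = 0`. -/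
theorem exists_uniformizes_blowup (k : Fin n) (𝒰 : Ultrafilter (Fin (n + 1) → ℝ))
    (h𝒰 : (𝒰 : Filter (Fin (n + 1) → ℝ)) ≤ 𝓝 0) :
    (∃ (w : ℝ) (s : _), Uniformizes (𝒰 : Filter (Fin (n + 1) → ℝ))
      (fun X => Fin.cons (X k.succ * (w + X 0)) (Fin.tail X)) s) ∨
    ∃ s, Uniformizes (𝒰 : Filter (Fin (n + 1) → ℝ))
      (fun X => Fin.cons (X 0) (Function.update (Fin.tail X) k (X k.succ * X 0))) s := by
  have hc0 := (analyticAt_coord (0 : Fin (n + 1)) 0).continuousAt.tendsto.mono_left h𝒰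
  have hct := (analyticAt_tail (0 : Fin (n + 1) → ℝ)).continuousAt.tendsto.mono_left h𝒰
  by_cases hM : ∃ M : ℝ, ∀ᶠ X in (𝒰 : Filter (Fin (n + 1) → ℝ)), |X 0| ≤ M * |X k.succ|
  · left
    obtain ⟨M, hM⟩ := hM
    set q : (Fin (n + 1) → ℝ) → ℝ := fun X => X 0 / X k.succ with hq
    have hqM : ∀ᶠ X in (𝒰 : Filter (Fin (n + 1) → ℝ)), q X ∈ Set.Icc (-|M|) |M| := by
      filter_upwards [hM] with X hX
      rw [Set.mem_Icc, ← abs_le, hq, abs_div]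
      refine div_le_of_le_mul₀ (abs_nonneg _) (abs_nonneg _) (hX.trans ?_)
      gcongr
      exact le_abs_self M
    obtain ⟨w, -, hw⟩ := (isCompact_Icc (a := -|M|) (b := |M|)).ultrafilter_le_nhds (𝒰.map q)
      (le_principal_iff.2 hqM)
    refine ⟨w, fun X => Fin.cons (q X - w) (Fin.tail X), ?_, ?_, ?_, ?_⟩
    · exact analyticAt_cons ((analyticAt_coord _ 0).fun_mul
        (analyticAt_const.fun_add (analyticAt_coord _ 0))) (analyticAt_tail 0)
    · simp [tail_zero, cons_zero_zero]
    · refine tendsto_cons ?_ hct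
      have : Tendsto q 𝒰 (𝓝 w) := hw
      simpa using this.sub_const w
    · filter_upwards [hM] with X hX
      have : X k.succ * (w + (q X - w)) = X 0 := by
        rw [add_sub_cancel, hq]
        rcases eq_or_ne (X k.succ) 0 with h0 | h0
        · rw [h0, abs_zero, mul_zero, abs_nonpos_iff] at hX
          simp [h0, hX]
        · exact mul_div_cancel₀ _ h0
      simp only [Fin.cons_succ, Fin.cons_zero, Fin.tail_cons, Fin.tail] at this ⊢
      rw [this]
      exact Fin.cons_self_tail X
  · right
    push Not at hM
    refine ⟨fun X => Fin.cons (X 0) (Function.update (Fin.tail X) k (X k.succ / X 0)),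
      ?_, ?_, ?_, ?_⟩
    · refine analyticAt_cons (analyticAt_coord _ 0) (AnalyticAt.pi fun i => ?_)
      rcases eq_or_ne i k with rfl | hi
      · simpa using (analyticAt_coord i.succ (0 : Fin (n + 1) → ℝ)).fun_mul (analyticAt_coord 0 0)
      · simpa [hi, Fin.tail] using analyticAt_coord i.succ (0 : Fin (n + 1) → ℝ)
    · simp [tail_zero, cons_zero_zero]
    · refine tendsto_cons hc0 (tendsto_pi_nhds.2 fun i => ?_)
      rcases eq_or_ne i k with rfl | hi
      · simp only [Function.update_self, Pi.zero_apply]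
        rw [Metric.tendsto_nhds]
        intro ε hε
        filter_upwards [hM ε⁻¹, hM 0] with X hX hX0
        rw [Real.dist_eq, sub_zero, abs_div, div_lt_iff₀ (by simpa using hX0)]
        rwa [inv_mul_lt_iff₀ hε] at hX
      · simpa [hi, tail_zero] using (tendsto_pi_nhds.1 hct i)
    · filter_upwards [hM 0] with X hX
      have h0 : X 0 ≠ 0 := by simpa using hX
      ext i
      induction i using Fin.cases with
      | zero => simp
      | succ i =>
        rcases eq_or_ne i k with rfl | hi
        · simp [h0]
        · simp [hi, Fin.tail]

theorem resolvable_of_normal_form {e : ℕ} (IH : ∀ i ≤ e, RegularResolvable n i) (β : Fin n → ℕ)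
    {m : (Fin n → ℝ) → ℝ} (hm : AnalyticAt ℝ m 0) (hmm : IsMonomial m)
    {c : ℕ → (Fin n → ℝ) → ℝ} (hc : ∀ j, AnalyticAt ℝ (c j) 0) (hc0 : ∃ i < e, c i 0 ≠ 0)
    {u : (Fin (n + 1) → ℝ) → ℝ} (hu : AnalyticAt ℝ u 0) (hu0 : u 0 ≠ 0) :
    Resolvable fun X => m (Fin.tail X) * (∑ j ∈ Finset.range e,
      (∏ i, X i.succ ^ β i) ^ (e + 1 - j) * c j (Fin.tail X) * X 0 ^ j + X 0 ^ (e + 1) * u X) := by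
  have hprod : ∀ γ : Fin n → ℕ, AnalyticAt ℝ (fun X : Fin (n + 1) → ℝ => ∏ i, X i.succ ^ γ i) 0 :=
    fun γ => Finset.analyticAt_fun_prod _ fun i _ => (analyticAt_coord i.succ 0).fun_pow _
  induction hN : ∑ i, β i generalizing β m u with
  | zero =>
    have hβ : ∀ i, β i = 0 := by simpa using hN
    obtain ⟨i, hi, hci⟩ := hc0
    refine IH i hi.le _ m ?_ hm ?_
    · refine AnalyticAt.fun_add (Finset.analyticAt_fun_sum _ fun j _ => ?_)
        (((analyticAt_coord 0 0).fun_pow _).fun_mul hu)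
      exact (((hprod β).fun_pow _).fun_mul (analyticAt_comp_tail (hc j))).fun_mul
        ((analyticAt_coord 0 0).fun_pow _)
    · rw [iteratedDeriv_eq_of_expansion (c := fun j => c j 0)
        (U := fun t => t * u (Fin.cons t 0)) (d := e) ?_ ?_ hi]
      · exact mul_ne_zero (by exact_mod_cast i.factorial_ne_zero) hci
      · exact analyticAt_id.fun_mul
          (hu.comp_of_eq (analyticAt_cons analyticAt_id analyticAt_const) cons_zero_zero)
      · filter_upwards with t
        simp [hβ, pow_succ, mul_assoc]
  | succ N ih =>
    obtain ⟨k, hk⟩ : ∃ k, β k ≠ 0 := by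
      by_contra! hcon
      simp [hcon] at hN
    obtain ⟨γ, rfl, hγ⟩ := exists_eq_add_single hk
    have hγN : ∑ i, γ i = N := by omega
    have hsplit : ∀ X : Fin (n + 1) → ℝ, ∏ i, X i.succ ^ (γ + Pi.single k 1 : Fin n → ℕ) i =
        (∏ i, X i.succ ^ γ i) * X k.succ := fun X =>
      prod_pow_add_single (fun i => X i.succ) γ k
    refine Resolvable.of_uniformizes fun 𝒰 h𝒰 => ?_
    rcases exists_uniformizes_blowup k 𝒰 h𝒰 with ⟨w, s, hs⟩ | ⟨s, hs⟩
    · refine ⟨_, s, hs, ?_⟩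
      have hu' := hu.comp_of_eq hs.analyticAt hs.map_zero
      have hu0' : u (Fin.cons ((0 : Fin (n + 1) → ℝ) k.succ * (w + (0 : Fin (n + 1) → ℝ) 0))
        (Fin.tail (0 : Fin (n + 1) → ℝ))) ≠ 0 := by rwa [hs.map_zero]
      have hm' : AnalyticAt ℝ (fun x : Fin n → ℝ => m x * x k ^ (e + 1)) 0 :=
        hm.fun_mul ((analyticAt_coord k 0).fun_pow _)
      have key : ∀ X : Fin (n + 1) → ℝ, ∑ j ∈ Finset.range e,
          ((∏ i, X i.succ ^ γ i) * X k.succ) ^ (e + 1 - j) * c j (Fin.tail X) *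
            (X k.succ * (w + X 0)) ^ j = X k.succ ^ (e + 1) * ∑ j ∈ Finset.range e,
          (∏ i, X i.succ ^ γ i) ^ (e + 1 - j) * c j (Fin.tail X) * (w + X 0) ^ j := by
        intro X
        rw [Finset.mul_sum]
        refine Finset.sum_congr rfl fun j hj => ?_
        have : e + 1 = (e + 1 - j) + j := by have := Finset.mem_range.1 hj; omega
        conv_rhs => rw [this, pow_add, ← this]
        rw [mul_pow, mul_pow]
        ring
      rcases eq_or_ne w 0 with rfl | hw
      · refine (ih γ hm' (hmm.mul ((isMonomial_coord k).pow _)) hu' hu0' hγN).congr ?_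
        filter_upwards with X
        simp only [Function.comp_apply, Fin.tail_cons, Fin.cons_succ, Fin.cons_zero]
        have h1 := hsplit X
        simp only [Fin.tail] at h1 key ⊢
        rw [h1, key]
        simp only [zero_add]
        ring
      · refine (IH e le_rfl (fun X => ∑ j ∈ Finset.range e, (∏ i, X i.succ ^ γ i) ^ (e + 1 - j) *
          c j (Fin.tail X) * (w + X 0) ^ j + (w + X 0) ^ (e + 1) *
            u (Fin.cons (X k.succ * (w + X 0)) (Fin.tail X))) _ ?_ hm' ?_).congr ?_
        · have hw' : AnalyticAt ℝ (fun X : Fin (n + 1) → ℝ => w + X 0) 0 :=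
            analyticAt_const.fun_add (analyticAt_coord 0 0)
          refine AnalyticAt.fun_add (Finset.analyticAt_fun_sum _ fun j _ => ?_)
            ((hw'.fun_pow _).fun_mul hu')
          exact (((hprod γ).fun_pow _).fun_mul (analyticAt_comp_tail (hc j))).fun_mul
            (hw'.fun_pow _)
        · obtain ⟨A, hA⟩ : ∃ A : ℕ → ℝ, ∀ j, (∏ i, (0 : ℝ) ^ γ i) ^ (e + 1 - j) * c j 0 = A j :=
            ⟨_, fun _ => rfl⟩
          set p : Polynomial ℝ := ∑ j ∈ Finset.range e,
            Polynomial.C (A j) *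
              (Polynomial.X + Polynomial.C w) ^ j +
            Polynomial.C (u 0) * (Polynomial.X + Polynomial.C w) ^ (e + 1) with hp
          have hpe : p.coeff e = u 0 * (w * (e + 1)) := by
            rw [hp, Polynomial.coeff_add, Polynomial.finsetSum_coeff, Finset.sum_eq_zero]
            · rw [Polynomial.coeff_C_mul, Polynomial.coeff_X_add_C_pow]
              simp
            · intro j hj
              rw [Polynomial.coeff_C_mul, Polynomial.coeff_X_add_C_pow,
                Nat.choose_eq_zero_of_lt (Finset.mem_range.1 hj)]
              simp
          rw [iteratedDeriv_eq_of_expansion (c := p.coeff) (U := 0)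
            (d := max p.natDegree e + 1) analyticAt_const ?_ (by omega), hpe]
          · refine mul_ne_zero (by exact_mod_cast e.factorial_ne_zero)
              (mul_ne_zero hu0 (mul_ne_zero hw (by positivity)))
          · filter_upwards with t
            simp only [Pi.zero_apply, mul_zero, add_zero]
            rw [← Polynomial.eval_eq_sum_range' (by omega), hp]
            simp [Polynomial.eval_finsetSum, cons_zero_zero, hA, add_comm, mul_comm]
        · filter_upwards with X
          simp only [Function.comp_apply, Fin.tail_cons, Fin.cons_succ, Fin.cons_zero]
          have h1 := hsplit X
          simp only [Fin.tail] at h1 key ⊢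
          rw [h1, key, mul_pow (X k.succ) (w + X 0) (e + 1)]
          ring
    · refine ⟨_, s, hs, IsZeroOrMonomial.resolvable (Or.inr ?_)⟩
      set ψ : (Fin (n + 1) → ℝ) → Fin n → ℝ := fun X =>
        Function.update (Fin.tail X) k (X k.succ * X 0) with hψ
      have hψa : AnalyticAt ℝ ψ 0 := by
        have := (analyticAt_tail _).comp_of_eq hs.analyticAt hs.map_zero
        simpa [Function.comp_def] using this
      have hψ0 : ψ 0 = 0 := by simp [hψ, tail_zero]
      have hψm : ∀ i, IsMonomial fun X => ψ X i := by
        intro i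
        rcases eq_or_ne i k with rfl | hi
        · simpa [hψ] using (isMonomial_coord i.succ).mul (isMonomial_coord (0 : Fin (n + 1)))
        · simpa [hψ, hi, Fin.tail] using isMonomial_coord i.succ
      have hγa : AnalyticAt ℝ (fun X => ∏ i, ψ X i ^ γ i) 0 :=
        Finset.analyticAt_fun_prod _ fun i _ => (analyticAt_pi_iff.1 hψa i).fun_pow _
      have hsum : AnalyticAt ℝ (fun X => ∑ j ∈ Finset.range e,
          ((∏ i, ψ X i ^ γ i) * X k.succ) ^ (e + 1 - j) * c j (ψ X) +
            u (Fin.cons (X 0) (ψ X))) 0 := by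
        refine AnalyticAt.fun_add (Finset.analyticAt_fun_sum _ fun j _ => ?_)
          (hu.comp_of_eq hs.analyticAt hs.map_zero)
        exact ((hγa.fun_mul (analyticAt_coord k.succ 0)).fun_pow _).fun_mul
          ((hc j).comp_of_eq hψa hψ0)
      refine IsMonomial.congr ((hmm.comp hψa hψ0 hψm).mul
        (((isMonomial_coord 0).pow (e + 1)).mul (isMonomial_of_ne_zero hsum ?_))) ?_
      · rw [Finset.sum_eq_zero]
        · simpa [hψ0, cons_zero_zero] using hu0
        · intro j hj
          have : e + 1 - j ≠ 0 := by have := Finset.mem_range.1 hj; omega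
          simp [this]
      · filter_upwards with X
        have hψX : Function.update (Fin.tail X) k (X k.succ * X 0) = ψ X := rfl
        have hψk : ψ X k = X k.succ * X 0 := by simp [hψ]
        simp only [Function.comp_apply, Fin.tail_cons, Fin.cons_succ, Fin.cons_zero]
        rw [prod_pow_add_single, hψX, hψk]
        congr 1
        rw [mul_add, Finset.mul_sum]
        congr 1
        refine Finset.sum_congr rfl fun j hj => ?_
        have : e + 1 = (e + 1 - j) + j := by have := Finset.mem_range.1 hj; omega
        conv_rhs => rw [this, pow_add, ← this]
        ring

theorem exponent_eq_of_tendsto {a b c : ℕ} (hab : a < b) {p q r : ℝ → ℝ} {p₀ q₀ r₀ : ℝ}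
    (hp : Tendsto p (𝓝[>] 0) (𝓝 p₀)) (hq : Tendsto q (𝓝[>] 0) (𝓝 q₀))
    (hr : Tendsto r (𝓝[>] 0) (𝓝 r₀)) (hp₀ : p₀ ≠ 0) (hr₀ : r₀ ≠ 0)
    (h : ∀ᶠ t in 𝓝[>] (0 : ℝ), t ^ a * p t - t ^ b * q t = t ^ c * r t) : c = a := by
  have hpow : ∀ {d : ℕ}, d ≠ 0 → Tendsto (fun t : ℝ => t ^ d) (𝓝[>] 0) (𝓝 0) := fun {d} hd => by
    simpa [hd] using ((continuous_pow d).tendsto (0 : ℝ)).mono_left nhdsWithin_le_nhds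
  have hlim : Tendsto (fun t => p t - t ^ (b - a) * q t) (𝓝[>] 0) (𝓝 p₀) := by
    simpa using hp.sub ((hpow (Nat.sub_ne_zero_of_lt hab)).mul hq)
  have h' : ∀ᶠ t in 𝓝[>] (0 : ℝ), t ^ a * (p t - t ^ (b - a) * q t) = t ^ c * r t := by
    filter_upwards [h] with t ht
    rw [← ht, mul_sub, ← mul_assoc, ← pow_add, Nat.add_sub_cancel' hab.le]
  by_contra hne
  rcases Nat.lt_or_gt_of_ne hne with hca | hca
  · refine hr₀ (tendsto_nhds_unique hr ?_)
    have := (hpow (Nat.sub_ne_zero_of_lt hca)).mul hlim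
    rw [zero_mul] at this
    refine this.congr' ?_
    filter_upwards [h', self_mem_nhdsWithin] with t ht htpos
    have h0 : t ^ c ≠ 0 := (pow_pos htpos c).ne'
    refine mul_left_cancel₀ h0 ?_
    rw [← ht, ← mul_assoc, ← pow_add, Nat.add_sub_cancel' hca.le]
  · refine hp₀ (tendsto_nhds_unique hlim ?_)
    have := (hpow (Nat.sub_ne_zero_of_lt hca)).mul hr
    rw [zero_mul] at this
    refine this.congr' ?_
    filter_upwards [h', self_mem_nhdsWithin] with t ht htpos
    have h0 : t ^ a ≠ 0 := (pow_pos htpos a).ne'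
    refine mul_left_cancel₀ h0 ?_
    rw [ht, ← mul_assoc, ← pow_add, Nat.add_sub_cancel' hca.le]

theorem tendsto_curve {lam : Fin n → ℕ} (hlam : ∀ i, lam i ≠ 0) :
    Tendsto (fun (t : ℝ) i => t ^ lam i) (𝓝[>] 0) (𝓝 0) :=
  tendsto_pi_nhds.2 fun i => by
    simpa [hlam i] using ((continuous_pow (lam i)).tendsto (0 : ℝ)).mono_left nhdsWithin_le_nhds

theorem prod_curve (lam α : Fin n → ℕ) (t : ℝ) :
    ∏ i, (t ^ lam i) ^ α i = t ^ ∑ i, lam i * α i := by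
  simp only [← pow_mul, Finset.prod_pow_eq_pow_sum]

theorem weight_eq_of_sub_eventuallyEq {α β γ lam : Fin n → ℕ} (hlam : ∀ i, lam i ≠ 0)
    (hlt : ∑ i, lam i * α i < ∑ i, lam i * β i) {u v w : (Fin n → ℝ) → ℝ}
    (hu : AnalyticAt ℝ u 0) (hv : AnalyticAt ℝ v 0) (hw : AnalyticAt ℝ w 0) (hu0 : u 0 ≠ 0)
    (hw0 : w 0 ≠ 0)
    (h : ∀ᶠ x in 𝓝 0, (∏ i, x i ^ α i) * u x - (∏ i, x i ^ β i) * v x = (∏ i, x i ^ γ i) * w x) :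
    ∑ i, lam i * γ i = ∑ i, lam i * α i := by
  have ht := tendsto_curve hlam
  refine exponent_eq_of_tendsto hlt (hu.continuousAt.tendsto.comp ht)
    (hv.continuousAt.tendsto.comp ht) (hw.continuousAt.tendsto.comp ht) hu0 hw0 ?_
  filter_upwards [ht.eventually h] with t hx
  simpa only [prod_curve, Function.comp_apply] using hx

/-- If the difference of two monomials is zero or a monomial, then one divides the other. -/
theorem exponent_le_or_le_of_sub {α β : Fin n → ℕ} {u v : (Fin n → ℝ) → ℝ}
    (hu : AnalyticAt ℝ u 0) (hv : AnalyticAt ℝ v 0) (hu0 : u 0 ≠ 0) (hv0 : v 0 ≠ 0)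
    (h : IsZeroOrMonomial fun x => (∏ i, x i ^ α i) * u x - (∏ i, x i ^ β i) * v x) :
    α ≤ β ∨ β ≤ α := by
  by_contra! hcon
  obtain ⟨hαβ, hβα⟩ := hcon
  obtain ⟨k, hk⟩ : ∃ k, β k < α k := by simpa [Pi.le_def] using hαβ
  obtain ⟨l, hl⟩ : ∃ l, α l < β l := by simpa [Pi.le_def] using hβα
  set W : ℕ → ℕ → Fin n → ℕ := fun P Q i => 1 + P * (Pi.single l 1 : Fin n → ℕ) i +
    Q * (Pi.single k 1 : Fin n → ℕ) i with hW
  have hW0 : ∀ P Q i, W P Q i ≠ 0 := fun P Q i => by simp only [hW]; omega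
  have hsum : ∀ (P Q : ℕ) (γ : Fin n → ℕ),
      ∑ i, W P Q i * γ i = ∑ i, γ i + P * γ l + Q * γ k := by
    intro P Q γ
    simp only [hW, add_mul, Finset.sum_add_distrib, one_mul, mul_assoc, ← Finset.mul_sum]
    congr 3
    · rw [Finset.sum_eq_single l] <;> simp +contextual
    · rw [Finset.sum_eq_single k] <;> simp +contextual
  obtain ⟨M, hM⟩ : ∃ M, M = ∑ i, α i + ∑ i, β i + α k + β k + 1 := ⟨_, rfl⟩
  have hMl : M * α l + M ≤ M * β l := by
    have := Nat.mul_le_mul_left M hl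
    rwa [Nat.succ_eq_add_one, mul_add, mul_one] at this
  have hMk : M * β k + M ≤ M * α k := by
    have := Nat.mul_le_mul_left M hk
    rwa [Nat.succ_eq_add_one, mul_add, mul_one] at this
  rcases h with h | ⟨γ, w, hw, hw0, h⟩
  · have ht := tendsto_curve (hW0 M 0)
    have h1 : ∀ᶠ t in 𝓝[>] (0 : ℝ), t ^ (∑ i, W M 0 i * α i) *
        u (fun i => t ^ W M 0 i) - t ^ (∑ i, W M 0 i * β i) * v (fun i => t ^ W M 0 i) =
          t ^ (∑ i, W M 0 i * α i + 1) * 0 := by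
      filter_upwards [ht.eventually h] with t hx
      simpa only [prod_curve, mul_zero, Pi.zero_apply] using hx
    have hlt : ∑ i, W M 0 i * α i < ∑ i, W M 0 i * β i := by rw [hsum, hsum]; omega
    have h2 : ∀ᶠ t in 𝓝[>] (0 : ℝ), t ^ (∑ i, W M 0 i * α i) *
        (u (fun i => t ^ W M 0 i) + t) - t ^ (∑ i, W M 0 i * β i) * v (fun i => t ^ W M 0 i) =
          t ^ (∑ i, W M 0 i * α i + 1) * 1 := by
      filter_upwards [h1] with t ht
      rw [mul_add, add_sub_right_comm, ht]
      ring
    have hid : Tendsto (fun t : ℝ => t) (𝓝[>] 0) (𝓝 0) := nhdsWithin_le_nhds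
    have := exponent_eq_of_tendsto hlt
      (by simpa using (hu.continuousAt.tendsto.comp ht).add hid)
      (hv.continuousAt.tendsto.comp ht) tendsto_const_nhds hu0 one_ne_zero h2
    omega
  · have h1 := weight_eq_of_sub_eventuallyEq (hW0 M 0) (by rw [hsum, hsum]; omega)
      hu hv hw hu0 hw0 h
    have h2 := weight_eq_of_sub_eventuallyEq (hW0 M 1) (by rw [hsum, hsum]; omega)
      hu hv hw hu0 hw0 h
    have h' : ∀ᶠ x in 𝓝 (0 : Fin n → ℝ), (∏ i, x i ^ β i) * v x - (∏ i, x i ^ α i) * u x =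
        (∏ i, x i ^ γ i) * -w x := by
      filter_upwards [h] with x hx
      linarith
    have h3 := weight_eq_of_sub_eventuallyEq (hW0 0 M) (by rw [hsum, hsum]; omega)
      hv hu hw.fun_neg hv0 (neg_ne_zero.2 hw0) h'
    have h4 := weight_eq_of_sub_eventuallyEq (hW0 0 (M + 1))
      (by rw [hsum, hsum, add_mul, add_mul]; omega) hv hu hw.fun_neg hv0 (neg_ne_zero.2 hw0) h'
    rw [hsum, hsum] at h1 h2 h3 h4
    rw [add_mul, add_mul] at h4
    omega

/-- Extraction of roots of the coordinates. -/
theorem exists_uniformizes_pow (𝒰 : Ultrafilter (Fin n → ℝ))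
    (h𝒰 : (𝒰 : Filter (Fin n → ℝ)) ≤ 𝓝 0) {D : ℕ} (hD : D ≠ 0) :
    ∃ (σ : Fin n → ℝ) (s : _), (∀ i, σ i ≠ 0) ∧
      Uniformizes (𝒰 : Filter (Fin n → ℝ)) (fun x i => σ i * x i ^ D) s := by
  classical
  have hσ : ∀ i, ∃ σ : ℝ, σ ≠ 0 ∧ ∀ᶠ x in (𝒰 : Filter (Fin n → ℝ)), σ * |x i| = x i := by
    intro i
    rcases Ultrafilter.eventually_or.1 (Eventually.of_forall
      (fun x : Fin n → ℝ => le_total 0 (x i)) : ∀ᶠ x in (𝒰 : Filter (Fin n → ℝ)), _) with h | h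
    · exact ⟨1, one_ne_zero, h.mono fun x hx => by rw [abs_of_nonneg hx, one_mul]⟩
    · exact ⟨-1, by norm_num, h.mono fun x hx => by rw [abs_of_nonpos hx]; ring⟩
  choose σ hσ0 hσ using hσ
  refine ⟨σ, fun x i => |x i| ^ (D : ℝ)⁻¹, hσ0, ?_, ?_, ?_, ?_⟩
  · exact AnalyticAt.pi fun i => analyticAt_const.fun_mul ((analyticAt_coord i 0).fun_pow D)
  · ext i
    simp [hD]
  · refine tendsto_pi_nhds.2 fun i => ?_
    have hc : Continuous fun x : Fin n → ℝ => |x i| ^ (D : ℝ)⁻¹ :=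
      (continuous_apply i).abs.rpow_const fun _ => Or.inr (by positivity)
    have := (hc.tendsto 0).mono_left h𝒰
    simpa [hD] using this
  · filter_upwards [eventually_all.2 hσ] with x hx
    ext i
    rw [Real.rpow_inv_natCast_pow (abs_nonneg _) hD, hx i]

theorem exists_uniformizes_normal_form
    (hn : ∀ f : (Fin n → ℝ) → ℝ, AnalyticAt ℝ f 0 → Resolvable f) (e : ℕ)
    {m : (Fin n → ℝ) → ℝ} (hm : AnalyticAt ℝ m 0) {c : ℕ → (Fin n → ℝ) → ℝ}
    (hc : ∀ j, AnalyticAt ℝ (c j) 0) (𝒰 : Ultrafilter (Fin n → ℝ))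
    (h𝒰 : (𝒰 : Filter (Fin n → ℝ)) ≤ 𝓝 0) :
    ∃ φ s, Uniformizes (𝒰 : Filter (Fin n → ℝ)) φ s ∧ IsZeroOrMonomial (m ∘ φ) ∧
      ((∀ j < e, c j ∘ φ =ᶠ[𝓝 0] 0) ∨
      ∃ (β : Fin n → ℕ) (c' : ℕ → (Fin n → ℝ) → ℝ), (∀ j, AnalyticAt ℝ (c' j) 0) ∧
        (∃ i < e, c' i 0 ≠ 0) ∧
        ∀ j < e, c j ∘ φ =ᶠ[𝓝 0] fun x => (∏ i, x i ^ β i) ^ (e + 1 - j) * c' j x) := by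
  set D := (e + 1).factorial with hD
  set p : ℕ → ℕ := fun j => D / (e + 1 - j) with hp
  have hpD : ∀ j < e, (e + 1 - j) * p j = D := fun j hj =>
    Nat.mul_div_cancel' (Nat.dvd_factorial (by omega) (by omega))
  obtain ⟨φ, s, hφ, hfam⟩ := exists_uniformizes_family hn
    (Finset.univ : Finset (Option (Fin e ⊕ Fin e × Fin e)))
    (fun i => match i with
      | none => m
      | some (Sum.inl j) => c j
      | some (Sum.inr (i, j)) => fun x => c i x ^ p i - c j x ^ p j)
    (by
      rintro (_ | j | ⟨i, j⟩) -
      · exact hm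
      · exact hc j
      · exact ((hc i).fun_pow _).fun_sub ((hc j).fun_pow _)) 𝒰 h𝒰
  have hmφ : IsZeroOrMonomial (m ∘ φ) := hfam none (Finset.mem_univ _)
  have hcφ : ∀ j : ℕ, ∃ (α : Fin n → ℕ) (v : (Fin n → ℝ) → ℝ), AnalyticAt ℝ v 0 ∧
      (v = 0 ∨ v 0 ≠ 0) ∧ (j < e → c j ∘ φ =ᶠ[𝓝 0] fun x => (∏ i, x i ^ α i) * v x) := by
    intro j
    by_cases hj : j < e
    · have h : IsZeroOrMonomial (c j ∘ φ) := hfam (some (Sum.inl ⟨j, hj⟩)) (Finset.mem_univ _)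
      rcases h with h | ⟨α, v, hv, hv0, h⟩
      · exact ⟨0, 0, analyticAt_const, Or.inl rfl, fun _ => by simpa using! h⟩
      · exact ⟨α, v, hv, Or.inr hv0, fun _ => h⟩
    · exact ⟨0, 0, analyticAt_const, Or.inl rfl, fun h => absurd h hj⟩
  choose α v hv hv0 hcv using hcφ
  by_cases hall : ∀ j < e, v j = 0
  · refine ⟨φ, s, hφ, hmφ, Or.inl fun j hj => ?_⟩
    filter_upwards [hcv j hj] with x hx
    rw [hx, hall j hj]
    simp
  · push Not at hall
    obtain ⟨i, ⟨hi, hvi⟩, hmin⟩ := WellFounded.has_min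
      (InvImage.wf (fun j => p j * ∑ k, α j k) Nat.lt_wfRel.wf) {j | j < e ∧ v j ≠ 0} hall
    have hle : ∀ j < e, v j ≠ 0 → p i • α i ≤ p j • α j := by
      intro j hj hvj
      have hdiff : IsZeroOrMonomial ((fun x => c i x ^ p i - c j x ^ p j) ∘ φ) :=
        hfam (some (Sum.inr (⟨i, hi⟩, ⟨j, hj⟩))) (Finset.mem_univ _)
      have hcmp : p i • α i ≤ p j • α j ∨ p j • α j ≤ p i • α i := by
        refine exponent_le_or_le_of_sub ((hv i).fun_pow (p i)) ((hv j).fun_pow (p j))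
          (pow_ne_zero _ ((hv0 i).resolve_left hvi)) (pow_ne_zero _ ((hv0 j).resolve_left hvj))
          (hdiff.congr ?_)
        filter_upwards [hcv i hi, hcv j hj] with x hxi hxj
        simp only [Function.comp_apply] at hxi hxj ⊢
        rw [hxi, hxj, mul_pow, mul_pow]
        simp only [← Finset.prod_pow, ← pow_mul, Pi.smul_apply, smul_eq_mul, mul_comm (p _)]
      refine hcmp.elim id fun hji => ?_
      have hsum : ∑ k, (p j • α j) k = ∑ k, (p i • α i) k := by
        refine le_antisymm (Finset.sum_le_sum fun k _ => hji k) ?_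
        simp only [Pi.smul_apply, smul_eq_mul, ← Finset.mul_sum]
        exact not_lt.1 (hmin j ⟨hj, hvj⟩)
      have := (Finset.sum_eq_sum_iff_of_le fun k _ => hji k).1 hsum
      exact fun k => (this k (Finset.mem_univ k)).ge
    obtain ⟨σ, t, hσ, ht⟩ := exists_uniformizes_pow (𝒰.map s) hφ.tendsto
      (D := D) (Nat.factorial_ne_zero _)
    set ρ : (Fin n → ℝ) → Fin n → ℝ := fun x k => σ k * x k ^ D with hρ
    have hρm : ∀ k, IsMonomial fun x => ρ x k := fun k =>
      (isMonomial_of_ne_zero analyticAt_const (hσ k)).mul ((isMonomial_coord k).pow D)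
    refine ⟨φ ∘ ρ, t ∘ s, hφ.comp ht, ?_, Or.inr ⟨p i • α i, fun j x =>
      (∏ k, x k ^ (D * α j k - (e + 1 - j) * (p i * α i k))) *
        ((∏ k, σ k ^ α j k) * v j (ρ x)), fun j => ?_, ⟨i, hi, ?_⟩, fun j hj => ?_⟩⟩
    · rcases hmφ with h | h
      · exact Or.inl (ht.tendsto_nhds.eventually h)
      · exact Or.inr (h.comp ht.analyticAt ht.map_zero hρm)
    · exact (Finset.analyticAt_fun_prod _ fun k _ => (analyticAt_coord k 0).fun_pow _).fun_mul
        (analyticAt_const.fun_mul ((hv j).comp_of_eq ht.analyticAt ht.map_zero))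
    · have : ρ 0 = 0 := ht.map_zero
      simp only [this, ← mul_assoc, hpD i hi, Nat.sub_self, pow_zero, Finset.prod_const_one,
        one_mul]
      exact mul_ne_zero (Finset.prod_ne_zero_iff.2 fun k _ => pow_ne_zero _ (hσ k))
        ((hv0 i).resolve_left hvi)
    · filter_upwards [ht.tendsto_nhds.eventually (hcv j hj)] with x hx
      simp only [Function.comp_apply] at hx ⊢
      rw [hx]
      by_cases hvj : v j = 0
      · simp [hvj]
      · have hexp : ∀ k, (e + 1 - j) * (p i * α i k) ≤ D * α j k := by
          intro k
          rw [← hpD j hj, mul_assoc]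
          exact Nat.mul_le_mul_left _ (hle j hj hvj k)
        rw [← mul_assoc, ← mul_assoc]
        congr 1
        simp only [hρ, mul_pow, ← Finset.prod_pow, ← Finset.prod_mul_distrib, ← pow_mul,
          Pi.smul_apply, smul_eq_mul]
        refine Finset.prod_congr rfl fun k _ => ?_
        rw [mul_comm (σ k ^ _), mul_comm (p i * α i k), ← pow_add, Nat.add_sub_cancel' (hexp k)]

open scoped ContDiff in
/-- The implicit function theorem for analytic functions with values in `ℝ`. -/
theorem exists_analyticAt_implicit {C : (Fin (n + 1) → ℝ) → ℝ} (hC : AnalyticAt ℝ C 0)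
    (h0 : C 0 = 0) (hd : deriv (fun s => C (Fin.cons s 0)) 0 ≠ 0) :
    ∃ φ : (Fin n → ℝ) → ℝ, AnalyticAt ℝ φ 0 ∧ φ 0 = 0 ∧
      ∀ᶠ x in 𝓝 0, C (Fin.cons (φ x) x) = 0 := by
  set f : (Fin n → ℝ) × ℝ → ℝ := fun p => C (Fin.cons p.2 p.1) with hf
  have hfa : AnalyticAt ℝ f (0, 0) :=
    hC.comp_of_eq (analyticAt_cons analyticAt_snd analyticAt_fst) cons_zero_zero
  have hfc : ContDiffAt ℝ ω f (0, 0) := hfa.contDiffAt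
  set L := fderiv ℝ f (0, 0) ∘L .inr ℝ (Fin n → ℝ) ℝ with hL
  have hL1 : L 1 ≠ 0 := by
    have h1 : HasDerivAt (fun s => f (0, s)) (L 1) 0 := by
      have h2 : HasFDerivAt (fun s : ℝ => ((0 : Fin n → ℝ), s)) (.inr ℝ (Fin n → ℝ) ℝ) 0 :=
        hasFDerivAt_prodMk_right _ _
      exact (hfa.differentiableAt.hasFDerivAt.comp (0 : ℝ) h2).hasDerivAt
    rwa [← h1.deriv]
  have hLs : ∀ s, L s = s * L 1 := fun s => by
    conv_lhs => rw [← mul_one s, ← smul_eq_mul, map_smul, smul_eq_mul]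
  have hinv : L.IsInvertible := by
    refine ContinuousLinearMap.IsInvertible.of_inverse
      (g := (L 1)⁻¹ • ContinuousLinearMap.id ℝ ℝ) ?_ ?_
    · ext
      simp [hL1]
    · ext
      simp [hL1]
  refine ⟨hfc.implicitFunction (by simp) hinv,
    (hfc.contDiffAt_implicitFunction (by simp) hinv).analyticAt,
    hfc.implicitFunction_apply_self (by simp) hinv, ?_⟩
  filter_upwards [hfc.eventually_apply_implicitFunction (by simp) hinv] with x hx
  simpa [hf, cons_zero_zero, h0] using hx

/-- Tschirnhaus transformation: a translation in the first variable removes the coefficient of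
subleading degree. -/
theorem exists_tschirnhaus {g : (Fin (n + 1) → ℝ) → ℝ} (hg : AnalyticAt ℝ g 0) {e : ℕ}
    (he : iteratedDeriv e (fun t => g (Fin.cons t 0)) 0 = 0)
    (he' : iteratedDeriv (e + 1) (fun t => g (Fin.cons t 0)) 0 ≠ 0) :
    ∃ (φ : (Fin n → ℝ) → ℝ) (c : ℕ → (Fin n → ℝ) → ℝ) (u : (Fin (n + 1) → ℝ) → ℝ),
      AnalyticAt ℝ φ 0 ∧ φ 0 = 0 ∧ (∀ j, AnalyticAt ℝ (c j) 0) ∧ AnalyticAt ℝ u 0 ∧ u 0 ≠ 0 ∧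
      ∀ᶠ X in 𝓝 0, g (Fin.cons (X 0 + φ (Fin.tail X)) (Fin.tail X)) =
        ∑ j ∈ Finset.range e, c j (Fin.tail X) * X 0 ^ j + X 0 ^ (e + 1) * u X := by
  set h : ℝ → ℝ := fun t => g (Fin.cons t 0) with hh
  have hGa : AnalyticAt ℝ (fun Y : Fin (n + 2) → ℝ =>
      g (Fin.cons (Y 1 + Y 0) (Fin.tail (Fin.tail Y)))) 0 := by
    refine hg.comp_of_eq (analyticAt_cons ((analyticAt_coord 1 0).fun_add (analyticAt_coord 0 0))
      ((analyticAt_tail _).comp (analyticAt_tail 0))) ?_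
    simp [tail_zero, cons_zero_zero]
  obtain ⟨C, U, hC, hU, hexp⟩ := exists_expansion hGa (e + 2)
  have hcoef : ∀ j < e + 2, ∀ᶠ s in 𝓝 (0 : ℝ),
      C j (Fin.cons s 0) = iteratedDeriv j h s / j.factorial := by
    intro j hj
    have ht : Tendsto (fun s : ℝ => (Fin.cons 0 (Fin.cons s 0) : Fin (n + 2) → ℝ)) (𝓝 0) (𝓝 0) :=
      tendsto_cons tendsto_const_nhds (tendsto_cons tendsto_id tendsto_const_nhds)
    filter_upwards [ht.eventually (hexp.eventually_nhds.and hU.eventually_analyticAt)]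
      with s ⟨hs, hUs⟩
    have ha : AnalyticAt ℝ (fun z : ℝ => (Fin.cons z (Fin.cons s 0) : Fin (n + 2) → ℝ)) 0 :=
      analyticAt_cons analyticAt_id analyticAt_const
    have := iteratedDeriv_eq_of_expansion (k := fun z => h (s + z))
      (c := fun j => C j (Fin.cons s 0)) (d := e + 2)
      (U := fun z => U (Fin.cons z (Fin.cons s 0))) (hUs.comp_of_eq ha rfl)
      (by
        filter_upwards [ha.continuousAt.eventually hs] with z hz
        simpa [hh] using hz) hj
    rw [iteratedDeriv_comp_const_add] at this
    simp only [add_zero] at this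
    rw [this, mul_div_cancel_left₀ _ (by exact_mod_cast j.factorial_ne_zero)]
  have hC0 : C e 0 = 0 := by
    have := (hcoef e (by omega)).self_of_nhds
    rwa [cons_zero_zero, he, zero_div] at this
  have hCd : deriv (fun s => C e (Fin.cons s 0)) 0 ≠ 0 := by
    rw [EventuallyEq.deriv_eq (hcoef e (by omega)), deriv_div_const, ← iteratedDeriv_succ]
    exact div_ne_zero he' (by exact_mod_cast e.factorial_ne_zero)
  have hC1 : C (e + 1) 0 ≠ 0 := by
    have := (hcoef (e + 1) (by omega)).self_of_nhds
    rw [cons_zero_zero] at this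
    rw [this]
    exact div_ne_zero he' (by exact_mod_cast (e + 1).factorial_ne_zero)
  obtain ⟨φ, hφ, hφ0, hCφ⟩ := exists_analyticAt_implicit (hC e) hC0 hCd
  have hS : AnalyticAt ℝ (fun x : Fin n → ℝ => (Fin.cons (φ x) x : Fin (n + 1) → ℝ)) 0 :=
    analyticAt_cons hφ analyticAt_id
  have hS0 : (Fin.cons (φ 0) 0 : Fin (n + 1) → ℝ) = 0 := by rw [hφ0, cons_zero_zero]
  have hT : AnalyticAt ℝ (fun X : Fin (n + 1) → ℝ =>
      (Fin.cons (X 0) (Fin.cons (φ (Fin.tail X)) (Fin.tail X)) : Fin (n + 2) → ℝ)) 0 :=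
    analyticAt_cons (analyticAt_coord 0 0) (hS.comp_of_eq (analyticAt_tail 0) rfl)
  have hT0 : (Fin.cons ((0 : Fin (n + 1) → ℝ) 0) (Fin.cons (φ (Fin.tail (0 : Fin (n + 1) → ℝ)))
      (Fin.tail (0 : Fin (n + 1) → ℝ))) :
      Fin (n + 2) → ℝ) = 0 := by
    rw [tail_zero, hS0, Pi.zero_apply, cons_zero_zero]
  refine ⟨φ, fun j x => C j (Fin.cons (φ x) x), fun X =>
    C (e + 1) (Fin.cons (φ (Fin.tail X)) (Fin.tail X)) +
      X 0 * U (Fin.cons (X 0) (Fin.cons (φ (Fin.tail X)) (Fin.tail X))), hφ, hφ0,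
    fun j => (hC j).comp_of_eq hS hS0, ?_, ?_, ?_⟩
  · exact ((hC _).comp_of_eq (hS.comp_of_eq (analyticAt_tail 0) rfl) hS0).fun_add
      ((analyticAt_coord 0 0).fun_mul (hU.comp_of_eq hT hT0))
  · simpa [tail_zero, hφ0, cons_zero_zero] using hC1
  · have htT := hT.continuousAt.tendsto
    rw [hT0] at htT
    filter_upwards [htT.eventually hexp, tendsto_tail.eventually hCφ] with X hX hX0
    simp only [Fin.tail_cons, Fin.cons_zero, Fin.cons_one] at hX
    rw [add_comm (X 0), hX, Finset.sum_range_succ, Finset.sum_range_succ, hX0]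
    ring

theorem uniformizes_translation {𝒰 : Filter (Fin (n + 1) → ℝ)} (h𝒰 : 𝒰 ≤ 𝓝 0)
    {φ : (Fin n → ℝ) → ℝ} (hφ : AnalyticAt ℝ φ 0) (h0 : φ 0 = 0) :
    Uniformizes 𝒰 (fun X => Fin.cons (X 0 + φ (Fin.tail X)) (Fin.tail X))
      (fun X => Fin.cons (X 0 - φ (Fin.tail X)) (Fin.tail X)) where
  analyticAt := analyticAt_cons ((analyticAt_coord 0 0).fun_add (analyticAt_comp_tail hφ))
    (analyticAt_tail 0)
  map_zero := by simp [tail_zero, h0, cons_zero_zero]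
  tendsto := by
    have := ((analyticAt_cons ((analyticAt_coord 0 0).fun_sub (analyticAt_comp_tail hφ))
      (analyticAt_tail 0)).continuousAt.tendsto).mono_left h𝒰
    simpa [tail_zero, h0, cons_zero_zero] using this
  section_eq := by
    filter_upwards with X
    simp

theorem uniformizes_shear {𝒰 : Filter (Fin (n + 1) → ℝ)} (h𝒰 : 𝒰 ≤ 𝓝 0) (v : Fin n → ℝ) :
    Uniformizes 𝒰 (fun X => Fin.cons (X 0) (Fin.tail X + X 0 • v))
      (fun X => Fin.cons (X 0) (Fin.tail X - X 0 • v)) where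
  analyticAt := analyticAt_cons (analyticAt_coord 0 0)
    ((analyticAt_tail 0).fun_add ((analyticAt_coord 0 0).fun_smul analyticAt_const))
  map_zero := by simp [tail_zero, cons_zero_zero]
  tendsto := by
    have := ((analyticAt_cons (analyticAt_coord 0 0) ((analyticAt_tail 0).fun_sub
      ((analyticAt_coord 0 0).fun_smul
        (analyticAt_const (v := v))))).continuousAt.tendsto).mono_left h𝒰
    simpa [tail_zero, cons_zero_zero] using this
  section_eq := by
    filter_upwards with X
    simp

theorem regularResolvable (hn : ∀ f : (Fin n → ℝ) → ℝ, AnalyticAt ℝ f 0 → Resolvable f) (d : ℕ) :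
    RegularResolvable n d := by
  induction d using Nat.strong_induction_on with
  | _ d IH =>
  intro g m hg hm hd
  by_cases hlow : ∃ i < d, iteratedDeriv i (fun t => g (Fin.cons t 0)) 0 ≠ 0
  · obtain ⟨i, hi, hi0⟩ := hlow
    exact IH i hi g m hg hm hi0
  push Not at hlow
  rcases d with _ | e
  · rw [iteratedDeriv_zero, cons_zero_zero] at hd
    refine Resolvable.of_uniformizes fun 𝒰 h𝒰 => ?_
    obtain ⟨φ, s, hφ, hmφ⟩ := hn m hm
      (𝒰.map (Fin.tail : (Fin (n + 1) → ℝ) → Fin n → ℝ)) (tendsto_tail.mono_left h𝒰)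
    have hl := Uniformizes.lift h𝒰 hφ
    refine ⟨_, _, hl, IsZeroOrMonomial.resolvable ?_⟩
    have := hmφ.comp_tail.mul (isMonomial_of_ne_zero (hg.comp_of_eq hl.analyticAt hl.map_zero)
      (by simpa [tail_zero, hφ.map_zero, cons_zero_zero] using hd))
    exact this.congr (by filter_upwards with X; simp)
  · obtain ⟨φ, c, u, hφ, hφ0, hc, hu, hu0, hexp⟩ := exists_tschirnhaus hg (hlow e (by omega)) hd
    refine Resolvable.of_uniformizes fun 𝒰 h𝒰 =>
      ⟨_, _, uniformizes_translation h𝒰 hφ hφ0, ?_⟩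
    refine Resolvable.congr (f := fun X => m (Fin.tail X) *
      (∑ j ∈ Finset.range e, c j (Fin.tail X) * X 0 ^ j + X 0 ^ (e + 1) * u X)) ?_
      (by filter_upwards [hexp] with X hX; simp [hX])
    clear h𝒰 𝒰
    refine Resolvable.of_uniformizes fun 𝒰 h𝒰 => ?_
    obtain ⟨ψ, s, hψ, hmψ, hcψ⟩ := exists_uniformizes_normal_form hn e hm hc
      (𝒰.map (Fin.tail : (Fin (n + 1) → ℝ) → Fin n → ℝ)) (tendsto_tail.mono_left h𝒰)
    have hl := Uniformizes.lift h𝒰 hψ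
    refine ⟨_, _, hl, ?_⟩
    have huψ := hu.comp_of_eq hl.analyticAt hl.map_zero
    have huψ0 :
        u (Fin.cons ((0 : Fin (n + 1) → ℝ) 0) (ψ (Fin.tail (0 : Fin (n + 1) → ℝ)))) ≠ 0 := by
      simpa [tail_zero, hψ.map_zero, cons_zero_zero] using hu0
    rcases hmψ with hm0 | hmm
    · refine IsZeroOrMonomial.resolvable (Or.inl ?_)
      filter_upwards [tendsto_tail.eventually hm0] with X hX
      simp only [Function.comp_apply, Pi.zero_apply] at hX
      simp [hX]
    rcases hcψ with hc0 | ⟨β, c', hc', hc'0, hcc'⟩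
    · refine IsZeroOrMonomial.resolvable (Or.inr ?_)
      refine (hmm.comp_tail.mul (((isMonomial_coord 0).pow (e + 1)).mul
        (isMonomial_of_ne_zero huψ huψ0))).congr ?_
      have hall : ∀ᶠ x in 𝓝 (0 : Fin n → ℝ), ∀ j ∈ Finset.range e, (c j ∘ ψ) x = 0 :=
        (eventually_all_finset _).2 fun j hj => hc0 j (Finset.mem_range.1 hj)
      filter_upwards [tendsto_tail.eventually hall] with X hX
      simp only [Function.comp_apply, Fin.tail_cons, Fin.cons_zero] at hX ⊢
      rw [Finset.sum_eq_zero fun j hj => by rw [hX j hj, zero_mul], zero_add]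
    · have hmψ' : AnalyticAt ℝ (m ∘ ψ) 0 := hm.comp_of_eq hψ.analyticAt hψ.map_zero
      refine (resolvable_of_normal_form (fun i hi => IH i (by omega)) β hmψ' hmm hc' hc'0
        huψ huψ0).congr ?_
      have hall : ∀ᶠ x in 𝓝 (0 : Fin n → ℝ), ∀ j ∈ Finset.range e,
          (c j ∘ ψ) x = (∏ i, x i ^ β i) ^ (e + 1 - j) * c' j x :=
        (eventually_all_finset _).2 fun j hj => hcc' j (Finset.mem_range.1 hj)
      filter_upwards [tendsto_tail.eventually hall] with X hX
      simp only [Function.comp_apply, Fin.tail_cons, Fin.cons_zero] at hX ⊢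
      congr 2
      exact Finset.sum_congr rfl fun j hj => by rw [hX j hj]; rfl

/-- A nonzero analytic germ has a line through the origin on which it has finite order. -/
theorem exists_iteratedDeriv_shear_ne_zero {f : (Fin (n + 1) → ℝ) → ℝ} (hf : AnalyticAt ℝ f 0)
    (hf0 : ¬ f =ᶠ[𝓝 0] 0) :
    ∃ (v : Fin n → ℝ) (d : ℕ), iteratedDeriv d (fun t => f (Fin.cons t (t • v))) 0 ≠ 0 := by
  have hfreq : ∃ᶠ X in 𝓝 0, f X * X 0 ≠ 0 := by
    by_contra hcon
    rw [not_frequently] at hcon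
    rcases hf.eventually_eq_zero_or_of_mul (analyticAt_coord 0 0)
      (hcon.mono fun X hX => not_not.1 hX) with h | h
    · exact hf0 h
    · have ht : Tendsto (fun t : ℝ => (Fin.cons t 0 : Fin (n + 1) → ℝ)) (𝓝[≠] 0) (𝓝 0) :=
        tendsto_cons nhdsWithin_le_nhds tendsto_const_nhds
      obtain ⟨t, ht1, ht2⟩ := ((ht.eventually h).and eventually_mem_nhdsWithin).exists
      exact ht2 (by simpa using ht1)
  obtain ⟨ε, hε, hball⟩ := Metric.eventually_nhds_iff_ball.1 hf.eventually_analyticAt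
  obtain ⟨X, hX, hXε⟩ := (hfreq.and_eventually (Metric.ball_mem_nhds 0 hε)).exists
  have hX0 : X 0 ≠ 0 := right_ne_zero_of_mul hX
  refine ⟨(X 0)⁻¹ • Fin.tail X, ?_⟩
  by_contra! hcon
  have hline : ∀ t : ℝ, (Fin.cons (t * X 0) ((t * X 0) • (X 0)⁻¹ • Fin.tail X) :
      Fin (n + 1) → ℝ) = t • X := by
    intro t
    ext i
    induction i using Fin.cases with
    | zero => simp
    | succ i => simp [Fin.tail, hX0, mul_assoc]
  have hh : AnalyticAt ℝ (fun t => f (Fin.cons t (t • (X 0)⁻¹ • Fin.tail X))) 0 := by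
    refine hf.comp_of_eq (analyticAt_cons analyticAt_id
      (analyticAt_id.fun_smul analyticAt_const)) ?_
    simp [cons_zero_zero]
  have horder : analyticOrderAt (fun t => f (Fin.cons t (t • (X 0)⁻¹ • Fin.tail X))) 0 = ⊤ := by
    refine ENat.eq_top_iff_forall_ge.2 fun d => ?_
    exact (natCast_le_analyticOrderAt_iff_iteratedDeriv_eq_zero hh).2 fun i _ => hcon i
  have hzero := analyticOrderAt_eq_top.1 horder
  have hk : AnalyticOnNhd ℝ (fun t : ℝ => f (t • X)) (Set.Icc 0 1) := by
    intro t ht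
    refine AnalyticAt.comp (g := f) (f := fun t : ℝ => t • X) (hball _ ?_)
      (analyticAt_id.fun_smul analyticAt_const)
    rw [mem_ball_zero_iff, norm_smul, Real.norm_of_nonneg ht.1]
    rw [dist_zero_right] at hXε
    exact (mul_le_of_le_one_left (norm_nonneg _) ht.2).trans_lt hXε
  have hk0 : (fun t : ℝ => f (t • X)) =ᶠ[𝓝 0] 0 := by
    have ht : Tendsto (fun t : ℝ => t * X 0) (𝓝 0) (𝓝 0) := by
      simpa using (continuous_mul_const (X 0)).tendsto 0
    filter_upwards [ht.eventually hzero] with t ht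
    rwa [hline] at ht
  have := hk.eqOn_zero_of_preconnected_of_eventuallyEq_zero isPreconnected_Icc
    (Set.left_mem_Icc.2 zero_le_one) hk0 (Set.right_mem_Icc.2 zero_le_one)
  simp only [one_smul, Pi.zero_apply] at this
  exact left_ne_zero_of_mul hX this

/-- Local uniformization of real analytic germs along ultrafilters. -/
theorem resolvable_of_analyticAt (f : (Fin n → ℝ) → ℝ) (hf : AnalyticAt ℝ f 0) :
    Resolvable f := by
  induction n with
  | zero =>
    refine IsZeroOrMonomial.resolvable ?_
    by_cases h : f 0 = 0
    · exact Or.inl (Eventually.of_forall fun x => by rw [Subsingleton.elim x 0]; exact h)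
    · exact Or.inr (isMonomial_of_ne_zero hf h)
  | succ n ih =>
    by_cases hf0 : f =ᶠ[𝓝 0] 0
    · exact IsZeroOrMonomial.resolvable (Or.inl hf0)
    obtain ⟨v, d, hd⟩ := exists_iteratedDeriv_shear_ne_zero hf hf0
    refine Resolvable.of_uniformizes fun 𝒰 h𝒰 => ?_
    have hs := uniformizes_shear h𝒰 v
    refine ⟨_, _, hs, ?_⟩
    refine Resolvable.congr (regularResolvable ih d _ (fun _ => 1)
      (hf.comp_of_eq hs.analyticAt hs.map_zero) analyticAt_const ?_) ?_
    · simpa [Fin.tail_cons] using hd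
    · filter_upwards with X
      simp

/-- Derivative of a monomial times a unit along the `k`-th Euler field. -/
theorem fderiv_monomial_mul_apply_single {u : (Fin n → ℝ) → ℝ} {x : Fin n → ℝ}
    (hu : DifferentiableAt ℝ u x) (α : Fin n → ℕ) (k : Fin n) :
    fderiv ℝ (fun x => (∏ i, x i ^ α i) * u x) x (Pi.single k (x k)) =
      (∏ i, x i ^ α i) * (α k * u x + fderiv ℝ u x (Pi.single k (x k))) := by
  set v : Fin n → ℝ := Pi.single k (x k) with hv
  have hγ : HasDerivAt (fun t : ℝ => x + t • v) v 0 := by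
    simpa using ((hasDerivAt_id (0 : ℝ)).smul_const v).const_add x
  have hcomp : ∀ {g : (Fin n → ℝ) → ℝ}, DifferentiableAt ℝ g x →
      HasDerivAt (fun t : ℝ => g (x + t • v)) (fderiv ℝ g x v) 0 := fun {g} hg => by
    have hg' : HasFDerivAt g (fderiv ℝ g x) (x + (0 : ℝ) • v) := by
      simpa using hg.hasFDerivAt
    exact hg'.comp_hasDerivAt (0 : ℝ) hγ
  have hP : ∀ t : ℝ, ∏ i, (x + t • v) i ^ α i = (1 + t) ^ α k * ∏ i, x i ^ α i := by
    intro t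
    rw [← Finset.mul_prod_erase _ _ (Finset.mem_univ k),
      ← Finset.mul_prod_erase _ (fun i => x i ^ α i) (Finset.mem_univ k), ← mul_assoc,
      ← mul_pow]
    congr 1
    · simp [hv]; ring
    · refine Finset.prod_congr rfl fun i hi => ?_
      simp [hv, Finset.ne_of_mem_erase hi]
  have h1 := hcomp (g := fun x => (∏ i, x i ^ α i) * u x) (by fun_prop)
  simp only [hP] at h1
  have h2 := (((((hasDerivAt_id (0 : ℝ)).const_add 1).pow (α k)).mul_const
    (∏ i, x i ^ α i)).mul (hcomp hu))
  refine (h1.unique h2).trans ?_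
  simp
  ring

/-- The gradient inequality for a monomial times a unit. -/
theorem IsMonomial.exists_abs_le_mul_norm_fderiv {h : (Fin n → ℝ) → ℝ} (hh : IsMonomial h)
    (h0 : h 0 = 0) : ∃ θ > (0 : ℝ), ∃ C > (0 : ℝ),
      ∀ᶠ x in 𝓝 0, |h x| ≤ C * |h x| ^ θ * ‖fderiv ℝ h x‖ := by
  obtain ⟨α, u, hu, hu0, he⟩ := hh
  have hsupp : (Finset.univ.filter fun i => α i ≠ 0).Nonempty := by
    by_contra hcon
    rw [Finset.not_nonempty_iff_eq_empty, Finset.filter_eq_empty_iff] at hcon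
    have := he.self_of_nhds
    rw [h0] at this
    simp only [Pi.zero_apply] at this
    rw [Finset.prod_eq_one fun i hi => by rw [not_not.1 (hcon hi), pow_zero], one_mul] at this
    exact hu0 this.symm
  set A : ℕ := ∑ i, α i with hA
  have hApos : 0 < A := by
    obtain ⟨k, hk⟩ := hsupp
    exact (Nat.pos_of_ne_zero (Finset.mem_filter.1 hk).2).trans_le
      (Finset.single_le_sum (fun _ _ => Nat.zero_le _) (Finset.mem_univ k))
  set c : ℝ := |u 0| / 2 with hc
  have hcpos : 0 < c := by positivity
  have hcu : c < |u 0| := by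
    have := abs_pos.2 hu0
    linarith
  have hlarge : ∀ᶠ x in 𝓝 0, c < |u x| := hu.continuousAt.abs.eventually_const_lt hcu
  have hsmall : ∀ᶠ x in 𝓝 0, ‖fderiv ℝ u x‖ * ‖x‖ < c / 2 := by
    have : ContinuousAt (fun x => ‖fderiv ℝ u x‖ * ‖x‖) 0 :=
      hu.fderiv.continuousAt.norm.mul continuousAt_id.norm
    exact this.eventually_lt_const (by simpa using half_pos hcpos)
  refine ⟨(A : ℝ)⁻¹, by positivity, 2 * (c⁻¹) ^ (A : ℝ)⁻¹, by positivity, ?_⟩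
  filter_upwards [hlarge, hsmall, he.eventually_nhds, hu.eventually_analyticAt]
    with x hxl hxs hxe hxu
  replace hxe : h =ᶠ[𝓝 x] fun x => (∏ i, x i ^ α i) * u x := hxe
  obtain ⟨k, hk, hkmin⟩ := Finset.exists_min_image _ (fun i => |x i|) hsupp
  have hαk : (1 : ℝ) ≤ α k := by
    exact_mod_cast Nat.one_le_iff_ne_zero.2 (Finset.mem_filter.1 hk).2
  have hhx : |h x| = |∏ i, x i ^ α i| * |u x| := by rw [hxe.self_of_nhds, abs_mul]
  have hnorm : ‖(Pi.single k (x k) : Fin n → ℝ)‖ = |x k| := by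
    rw [Pi.norm_single, Real.norm_eq_abs]
  have hderiv : |h x| ≤ 2 * ‖fderiv ℝ h x‖ * |x k| := by
    have h1 := (fderiv ℝ h x).le_opNorm (Pi.single k (x k))
    rw [hxe.fderiv_eq, fderiv_monomial_mul_apply_single hxu.differentiableAt, ← hxe.fderiv_eq,
      hnorm, norm_mul, Real.norm_eq_abs, Real.norm_eq_abs] at h1
    have h2 : |fderiv ℝ u x (Pi.single k (x k))| ≤ c / 2 := by
      refine ((fderiv ℝ u x).le_opNorm _).trans (le_trans ?_ hxs.le)
      rw [hnorm]
      exact mul_le_mul_of_nonneg_left (norm_le_pi_norm x k) (norm_nonneg _)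
    have h3 : |u x| / 2 ≤ |α k * u x + fderiv ℝ u x (Pi.single k (x k))| := by
      have h4 := abs_sub_abs_le_abs_add (α k * u x) (fderiv ℝ u x (Pi.single k (x k)))
      rw [abs_mul, Nat.abs_cast] at h4
      have h5 : |u x| ≤ α k * |u x| := le_mul_of_one_le_left (abs_nonneg _) hαk
      linarith
    have h6 := mul_le_mul_of_nonneg_left h3 (abs_nonneg (∏ i, x i ^ α i))
    rw [hhx]
    linarith
  have hpow : |x k| ^ A ≤ c⁻¹ * |h x| := by
    have h1 : |x k| ^ A ≤ |∏ i, x i ^ α i| := by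
      rw [hA, ← Finset.prod_pow_eq_pow_sum, Finset.abs_prod]
      refine Finset.prod_le_prod (fun _ _ => by positivity) fun i _ => ?_
      rw [abs_pow]
      by_cases hi : α i = 0
      · simp [hi]
      · exact pow_le_pow_left₀ (abs_nonneg _)
          (hkmin i (Finset.mem_filter.2 ⟨Finset.mem_univ i, hi⟩)) _
    rw [inv_mul_eq_div, le_div_iff₀ hcpos, hhx]
    exact mul_le_mul h1 hxl.le hcpos.le (abs_nonneg _)
  have hroot : |x k| ≤ c⁻¹ ^ (A : ℝ)⁻¹ * |h x| ^ (A : ℝ)⁻¹ := by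
    rw [← Real.mul_rpow (by positivity) (abs_nonneg _),
      ← Real.pow_rpow_inv_natCast (abs_nonneg (x k)) hApos.ne']
    exact Real.rpow_le_rpow (by positivity) hpow (by positivity)
  calc |h x| ≤ 2 * ‖fderiv ℝ h x‖ * |x k| := hderiv
    _ ≤ 2 * ‖fderiv ℝ h x‖ * (c⁻¹ ^ (A : ℝ)⁻¹ * |h x| ^ (A : ℝ)⁻¹) := by gcongr
    _ = _ := by ring

/-- Along a uniformizing ultrafilter, a function vanishing at the origin satisfies a gradient
inequality. -/
theorem Resolvable.exists_abs_le_mul_norm_fderiv {f : (Fin n → ℝ) → ℝ} (hr : Resolvable f)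
    (hf : AnalyticAt ℝ f 0) (h0 : f 0 = 0) (𝒰 : Ultrafilter (Fin n → ℝ))
    (h𝒰 : (𝒰 : Filter (Fin n → ℝ)) ≤ 𝓝 0) : ∃ θ > (0 : ℝ), ∃ C > (0 : ℝ),
      ∀ᶠ y in (𝒰 : Filter (Fin n → ℝ)), |f y| ≤ C * |f y| ^ θ * ‖fderiv ℝ f y‖ := by
  obtain ⟨φ, s, hφ, hz | hm⟩ := hr 𝒰 h𝒰
  · refine ⟨1, one_pos, 1, one_pos, ?_⟩
    filter_upwards [hφ.tendsto.eventually hz, hφ.section_eq] with y hy hsy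
    rw [Function.comp_apply, hsy, Pi.zero_apply] at hy
    simp [hy]
  obtain ⟨θ, hθ, C, hC, hineq⟩ := hm.exists_abs_le_mul_norm_fderiv
    (by rw [Function.comp_apply, hφ.map_zero, h0])
  have hbound : ∀ᶠ x in 𝓝 0, ‖fderiv ℝ φ x‖ < ‖fderiv ℝ φ 0‖ + 1 :=
    hφ.analyticAt.fderiv.continuousAt.norm.eventually_lt_const (lt_add_one _)
  refine ⟨θ, hθ, C * (‖fderiv ℝ φ 0‖ + 1), by positivity, ?_⟩
  filter_upwards [hφ.tendsto.eventually
    (hineq.and (hbound.and hφ.analyticAt.eventually_analyticAt)), hφ.section_eq,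
    h𝒰 hf.eventually_analyticAt] with y ⟨hy, hb, hφy⟩ hsy hfy
  have hfy' : DifferentiableAt ℝ f (φ (s y)) := by
    rw [hsy]
    exact hfy.differentiableAt
  rw [fderiv_comp _ hfy' hφy.differentiableAt, Function.comp_apply, hsy] at hy
  calc |f y| ≤ _ := hy
    _ ≤ C * |f y| ^ θ * (‖fderiv ℝ f y‖ * (‖fderiv ℝ φ 0‖ + 1)) := by
      gcongr
      refine (ContinuousLinearMap.opNorm_comp_le _ _).trans ?_
      gcongr
    _ = _ := by ring

theorem Resolvable.exists_rpow_le_norm_fderiv {f : (Fin n → ℝ) → ℝ} (hr : Resolvable f)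
    (hf : AnalyticAt ℝ f 0) (h0 : f 0 = 0) {c : ℝ} (hc : 0 < c) :
    ∃ θ ∈ Set.Ioo (0 : ℝ) (1 / 2), ∀ᶠ y in 𝓝 0, |f y| ^ (1 - θ) ≤ c * ‖fderiv ℝ f y‖ := by
  by_contra! hcon
  set θ : ℕ → ℝ := fun k => 1 / ((k + 2 : ℕ) + 1 : ℝ) with hθ
  have hθpos : ∀ k, 0 < θ k := fun k => by positivity
  have hθlt : ∀ k, θ k < 1 / 2 := fun k => by
    refine one_div_lt_one_div_of_lt two_pos ?_
    push_cast
    have : (0 : ℝ) ≤ k := k.cast_nonneg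
    linarith
  have hθlim : Tendsto θ atTop (𝓝 0) :=
    (tendsto_one_div_add_atTop_nhds_zero_nat (𝕜 := ℝ)).comp (tendsto_add_atTop_nat 2)
  have hseq : ∀ k, ∃ y : Fin n → ℝ,
      c * ‖fderiv ℝ f y‖ < |f y| ^ (1 - θ k) ∧ dist y 0 < θ k := fun k =>
    ((hcon (θ k) ⟨hθpos k, hθlt k⟩).and_eventually (Metric.ball_mem_nhds 0 (hθpos k))).exists
  choose y hy hyθ using hseq
  have hylim : Tendsto y atTop (𝓝 0) :=
    tendsto_iff_dist_tendsto_zero.2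
      (squeeze_zero (fun _ => dist_nonneg) (fun k => (hyθ k).le) hθlim)
  have hU : (hyperfilter ℕ : Filter ℕ) ≤ atTop := Nat.hyperfilter_le_atTop
  obtain ⟨τ, hτ, C, hC, hineq⟩ := hr.exists_abs_le_mul_norm_fderiv hf h0
    ((hyperfilter ℕ).map y) (hylim.mono_left hU)
  have hflim : Tendsto (fun k => |f (y k)|) atTop (𝓝 0) := by
    have := (hf.continuousAt.tendsto.comp hylim).abs
    simpa [h0] using this
  have hlim : Tendsto (fun k => C / c * |f (y k)| ^ (τ / 2)) atTop (𝓝 0) := by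
    have := (hflim.rpow_const (p := τ / 2) (Or.inr (by positivity))).const_mul (C / c)
    rwa [Real.zero_rpow (by positivity), mul_zero] at this
  have hev : ∀ᶠ k in (hyperfilter ℕ : Filter ℕ),
      |f (y k)| ≤ C * |f (y k)| ^ τ * ‖fderiv ℝ f (y k)‖ := hineq
  obtain ⟨k, hk, hk1, hkf, hkθ⟩ := (hev.and (hU ((hlim.eventually_lt_const one_pos).and
    ((hflim.eventually_lt_const one_pos).and (hθlim.eventually_lt_const (half_pos hτ)))))).exists
  have hpos : 0 < |f (y k)| := by
    refine (abs_nonneg _).lt_of_ne fun h => ?_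
    have := hy k
    rw [← h, Real.zero_rpow (by linarith [hθlt k])] at this
    exact absurd this (not_lt.2 (by positivity))
  have hlt : |f (y k)| < C / c * |f (y k)| ^ (τ / 2) * |f (y k)| := by
    calc |f (y k)| ≤ C * |f (y k)| ^ τ * ‖fderiv ℝ f (y k)‖ := hk
      _ = C / c * |f (y k)| ^ τ * (c * ‖fderiv ℝ f (y k)‖) := by field_simp
      _ < C / c * |f (y k)| ^ τ * |f (y k)| ^ (1 - θ k) := by
        gcongr
        exact hy k
      _ = C / c * |f (y k)| ^ (τ - θ k) * |f (y k)| := by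
        rw [mul_assoc, mul_assoc, ← Real.rpow_add hpos, ← Real.rpow_add_one hpos.ne']
        ring_nf
      _ ≤ C / c * |f (y k)| ^ (τ / 2) * |f (y k)| := by
        gcongr ?_ * ?_ * _
        exact Real.rpow_le_rpow_of_exponent_ge hpos hkf.le (by linarith)
  nlinarith

end Lojasiewicz

/-- Finite-dimensional Łojasiewicz gradient inequality. -/
theorem lojasiewicz_gradient_inequality
    (N : ℕ) (hN : 0 < N) (a : EuclideanSpace ℝ (Fin N))
    (Γ : EuclideanSpace ℝ (Fin N) → ℝ) (hΓ : AnalyticAt ℝ Γ a) :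
    ∃ σ > (0 : ℝ), ∃ θ ∈ Set.Ioo (0 : ℝ) (1 / 2),
      ∀ x : EuclideanSpace ℝ (Fin N), ‖x - a‖ < σ →
        ‖gradient Γ x‖ ≥ |Γ x - Γ a| ^ (1 - θ) := by
  set T := (EuclideanSpace.equiv (Fin N) ℝ).symm with hT
  set f : (Fin N → ℝ) → ℝ := fun y => Γ (a + T y) - Γ a with hf
  have hTa : ∀ y, HasFDerivAt (fun y => a + T y)
      (T : (Fin N → ℝ) →L[ℝ] EuclideanSpace ℝ (Fin N)) y :=
    fun y => T.hasFDerivAt.const_add a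
  have hfa : AnalyticAt ℝ f 0 := by
    refine AnalyticAt.fun_sub (hΓ.comp_of_eq (f := fun y => a + T y) ?_ ?_) analyticAt_const
    · exact analyticAt_const.fun_add
        ((T : (Fin N → ℝ) →L[ℝ] EuclideanSpace ℝ (Fin N)).analyticAt 0)
    · simp
  have hf0 : f 0 = 0 := by simp [hf]
  set M : ℝ := ‖(T : (Fin N → ℝ) →L[ℝ] EuclideanSpace ℝ (Fin N))‖ + 1 with hM
  have hMpos : 0 < M := by positivity
  obtain ⟨θ, hθ, hineq⟩ := (Lojasiewicz.resolvable_of_analyticAt f hfa).exists_rpow_le_norm_fderiv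
    hfa hf0 (inv_pos.2 hMpos)
  have ht : Tendsto (fun x => T.symm (x - a)) (𝓝 a) (𝓝 0) := by
    have : Continuous fun x => T.symm (x - a) := by fun_prop
    simpa using this.tendsto a
  obtain ⟨σ, hσ, hball⟩ := Metric.eventually_nhds_iff.1
    ((ht.eventually hineq).and hΓ.eventually_analyticAt)
  refine ⟨σ, hσ, θ, hθ, fun x hx => ?_⟩
  obtain ⟨h1, h2⟩ := hball (by rwa [dist_eq_norm])
  have hx' : a + T (T.symm (x - a)) = x := by simp
  have hfd : fderiv ℝ f (T.symm (x - a)) =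
      (fderiv ℝ Γ x).comp (T : (Fin N → ℝ) →L[ℝ] EuclideanSpace ℝ (Fin N)) := by
    have hΓx : HasFDerivAt Γ (fderiv ℝ Γ x) (a + T (T.symm (x - a))) := by
      rw [hx']
      exact h2.differentiableAt.hasFDerivAt
    exact ((hΓx.comp (T.symm (x - a)) (hTa (T.symm (x - a)))).sub_const (Γ a)).fderiv
  have hgrad : ‖gradient Γ x‖ = ‖fderiv ℝ Γ x‖ := by
    rw [gradient, LinearIsometryEquiv.norm_map]
  have hfx : f (T.symm (x - a)) = Γ x - Γ a := by simp only [hf, hx']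
  rw [hfx, hfd] at h1
  rw [ge_iff_le, hgrad]
  refine h1.trans ?_
  rw [inv_mul_le_iff₀ hMpos, mul_comm M]
  refine (ContinuousLinearMap.opNorm_comp_le _ _).trans ?_
  gcongr
  exact (lt_add_one _).le
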